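/- arXiv:1506.00949 — 2 statements merged into one kernel-verified Lean document; each statement's English description precedes it below -/
import Mathlib

section
/- Let Γ = (K, I, J, C, D, g, q) be a recursive game with signals in which player 1 is more informed than player 2, and let π ∈ Δ¹(K×C×D). For a strategy pair (σ,τ), let p_t = L_{P^π_{σ,τ}}(k_t | h_t¹) be player 1's conditional belief on the current state given his private history h_t¹, and let x_t = L_{P^π_{σ,τ}}(p_t | h_t²) be player 2's conditional law of p_t given his private history h_t². Then for every t ≥ 1 and every private history of positive probability, both p_t and x_t are independent of player 2's strategy τ: their values coincide under (σ,τ) and (σ,τ') for any strategies τ, τ' of player 2. -/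
open scoped Classical
open Filter

noncomputable section

namespace SigGame

variable {K I J C D : Type} [Fintype K] [Fintype I] [Fintype J] [Fintype C] [Fintype D]

/-- A behavior strategy of player 1 in a repeated game with signals: to every private
history (past signals and own past actions, plus the current signal), a mixed action. -/
structure Strat1 (C I : Type) [Fintype I] where
  play : List (C × I) → C → I → ℝ
  nonneg : ∀ h c i, 0 ≤ play h c i
  sum_one : ∀ h c, ∑ i, play h c i = 1

/-- A behavior strategy of player 2. -/
structure Strat2 (D J : Type) [Fintype J] where
  play : List (D × J) → D → J → ℝ
  nonneg : ∀ h d j, 0 ≤ play h d j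
  sum_one : ∀ h d, ∑ j, play h d j = 1

/-- The private history of player 1 (signals and own actions) along a full record. -/
def p1hist : List (K × C × D × I × J) → List (C × I) :=
  List.map (fun z => (z.2.1, z.2.2.2.1))

/-- The private history of player 2 (signals and own actions) along a full record. -/
def p2hist : List (K × C × D × I × J) → List (D × J) :=
  List.map (fun z => (z.2.2.1, z.2.2.2.2))

/-- Auxiliary: the probability of a finite record, given in reverse chronological
order, the last coordinate being the current (state, signal, signal) triple. -/
def recProbAux (q : K → I → J → K × C × D → ℝ) (π : K × C × D → ℝ)
    (σ : Strat1 C I) (τ : Strat2 D J) :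
    List (K × C × D × I × J) → (K × C × D) → ℝ
  | [], s => π s
  | z :: rest, s =>
      recProbAux q π σ τ rest (z.1, z.2.1, z.2.2.1) *
        σ.play (p1hist rest.reverse) z.2.1 z.2.2.2.1 *
        τ.play (p2hist rest.reverse) z.2.2.1 z.2.2.2.2 *
        q z.1 z.2.2.2.1 z.2.2.2.2 s

/-- Probability, under `(π, σ, τ)`, of a finite record of the play (the chronological
list of completed stages, and the current (state, signal, signal) triple). -/
def recProb (q : K → I → J → K × C × D → ℝ) (π : K × C × D → ℝ)
    (σ : Strat1 C I) (τ : Strat2 D J)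
    (r : List (K × C × D × I × J)) (s : K × C × D) : ℝ :=
  recProbAux q π σ τ r.reverse s

/-- Expected payoff of stage `t`. -/
def sPayoff (g : K → I → J → ℝ) (q : K → I → J → K × C × D → ℝ) (π : K × C × D → ℝ)
    (σ : Strat1 C I) (τ : Strat2 D J) (t : ℕ) : ℝ :=
  ∑' rs : List (K × C × D × I × J) × (K × C × D),
    if rs.1.length + 1 = t then
      recProb q π σ τ rs.1 rs.2 *
        ∑ i, ∑ j, σ.play (p1hist rs.1) rs.2.2.1 i *
          τ.play (p2hist rs.1) rs.2.2.2 j * g rs.2.1 i j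
    else 0

/-- Expected average payoff `γ_n(π, σ, τ)` of the first `n` stages. -/
def avgPay (g : K → I → J → ℝ) (q : K → I → J → K × C × D → ℝ) (π : K × C × D → ℝ)
    (σ : Strat1 C I) (τ : Strat2 D J) (n : ℕ) : ℝ :=
  (n : ℝ)⁻¹ * ∑ t ∈ Finset.Icc 1 n, sPayoff g q π σ τ t

/-- Expected `λ`-discounted payoff `γ_λ(π, σ, τ)`. -/
def discPay (g : K → I → J → ℝ) (q : K → I → J → K × C × D → ℝ) (π : K × C × D → ℝ)
    (σ : Strat1 C I) (τ : Strat2 D J) (lam : ℝ) : ℝ :=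
  ∑' t : ℕ, lam * (1 - lam) ^ t * sPayoff g q π σ τ (t + 1)

/-- The value `v_n(π)` of the `n`-stage game. -/
def vn (g : K → I → J → ℝ) (q : K → I → J → K × C × D → ℝ) (π : K × C × D → ℝ)
    (n : ℕ) : ℝ :=
  ⨆ σ : Strat1 C I, ⨅ τ : Strat2 D J, avgPay g q π σ τ n

/-- The value `v_λ(π)` of the `λ`-discounted game. -/
def vlam (g : K → I → J → ℝ) (q : K → I → J → K × C × D → ℝ) (π : K × C × D → ℝ)
    (lam : ℝ) : ℝ :=
  ⨆ σ : Strat1 C I, ⨅ τ : Strat2 D J, discPay g q π σ τ lam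

/-- Player 1 can (uniformly) guarantee the amount `w` in `Γ(π)`. -/
def P1Guarantees (g : K → I → J → ℝ) (q : K → I → J → K × C × D → ℝ)
    (π : K × C × D → ℝ) (w : ℝ) : Prop :=
  ∀ ε > (0 : ℝ), ∃ σ : Strat1 C I, ∃ n₀ : ℕ, 1 ≤ n₀ ∧
    ∀ n ≥ n₀, ∀ τ : Strat2 D J, avgPay g q π σ τ n ≥ w - ε

/-- Player 2 can defend the amount `w` in `Γ(π)`. -/
def P2Defends (g : K → I → J → ℝ) (q : K → I → J → K × C × D → ℝ)
    (π : K × C × D → ℝ) (w : ℝ) : Prop :=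
  ∀ ε > (0 : ℝ), ∀ σ : Strat1 C I, ∃ τ : Strat2 D J, ∃ n₀ : ℕ, 1 ≤ n₀ ∧
    ∀ n ≥ n₀, avgPay g q π σ τ n ≤ w + ε

/-- Player 2 can (uniformly) guarantee the amount `w` in `Γ(π)`. -/
def P2Guarantees (g : K → I → J → ℝ) (q : K → I → J → K × C × D → ℝ)
    (π : K × C × D → ℝ) (w : ℝ) : Prop :=
  ∀ ε > (0 : ℝ), ∃ τ : Strat2 D J, ∃ n₀ : ℕ, 1 ≤ n₀ ∧
    ∀ n ≥ n₀, ∀ σ : Strat1 C I, avgPay g q π σ τ n ≤ w + ε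

/-- Player 1 can defend the amount `w` in `Γ(π)`. -/
def P1Defends (g : K → I → J → ℝ) (q : K → I → J → K × C × D → ℝ)
    (π : K × C × D → ℝ) (w : ℝ) : Prop :=
  ∀ ε > (0 : ℝ), ∀ τ : Strat2 D J, ∃ σ : Strat1 C I, ∃ n₀ : ℕ, 1 ≤ n₀ ∧
    ∀ n ≥ n₀, avgPay g q π σ τ n ≥ w - ε

end SigGame

namespace SigGame

variable {K I J C D : Type} [Fintype K] [Fintype I] [Fintype J] [Fintype C] [Fintype D]

/-- Probability that player 1's private history at some stage is the given one and
that the current state is `k`. -/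
def p1jointProb (q : K → I → J → K × C × D → ℝ) (π : K × C × D → ℝ)
    (σ : Strat1 C I) (τ : Strat2 D J) (h1 : List (C × I) × C) (k : K) : ℝ :=
  ∑' rs : List (K × C × D × I × J) × (K × C × D),
    if p1hist rs.1 = h1.1 ∧ rs.2.2.1 = h1.2 ∧ rs.2.1 = k then recProb q π σ τ rs.1 rs.2
    else 0

/-- Probability that player 1's private history at some stage is the given one. -/
def p1histProb (q : K → I → J → K × C × D → ℝ) (π : K × C × D → ℝ)
    (σ : Strat1 C I) (τ : Strat2 D J) (h1 : List (C × I) × C) : ℝ :=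
  ∑' rs : List (K × C × D × I × J) × (K × C × D),
    if p1hist rs.1 = h1.1 ∧ rs.2.2.1 = h1.2 then recProb q π σ τ rs.1 rs.2 else 0

/-- Player 1's belief `p_t` on the current state, given his private history. -/
def belief (q : K → I → J → K × C × D → ℝ) (π : K × C × D → ℝ)
    (σ : Strat1 C I) (τ : Strat2 D J) (h1 : List (C × I) × C) : K → ℝ :=
  fun k => p1jointProb q π σ τ h1 k / p1histProb q π σ τ h1

/-- Probability that player 2's private history at some stage is the given one. -/
def p2histProb (q : K → I → J → K × C × D → ℝ) (π : K × C × D → ℝ)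
    (σ : Strat1 C I) (τ : Strat2 D J) (h2 : List (D × J) × D) : ℝ :=
  ∑' rs : List (K × C × D × I × J) × (K × C × D),
    if p2hist rs.1 = h2.1 ∧ rs.2.2.2 = h2.2 then recProb q π σ τ rs.1 rs.2 else 0

/-- Joint probability that player 2's private history is the given one and that
player 1's current belief `p_t` equals `φ`. -/
def p2beliefJoint (q : K → I → J → K × C × D → ℝ) (π : K × C × D → ℝ)
    (σ : Strat1 C I) (τ : Strat2 D J) (h2 : List (D × J) × D) (φ : K → ℝ) : ℝ :=
  ∑' rs : List (K × C × D × I × J) × (K × C × D),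
    if p2hist rs.1 = h2.1 ∧ rs.2.2.2 = h2.2 ∧
        belief q π σ τ (p1hist rs.1, rs.2.2.1) = φ then
      recProb q π σ τ rs.1 rs.2
    else 0

end SigGame

namespace SigGame

variable {K I J C D : Type} [Fintype I]

theorem of_sum_ite_eq_one {S : Type*} [Fintype S] {f : S → ℝ} {P : S → Prop}
    [DecidablePred P] (hf : ∀ s, 0 ≤ f s) (hf1 : ∑ s, f s = 1) (hP : ∑ s, (if P s then f s else 0) = 1)
    {s : S} (hs : f s ≠ 0) : P s := by
  by_contra hn
  refine (Finset.sum_lt_sum (fun t _ => ?_) ⟨s, Finset.mem_univ s, ?_⟩).ne (hP.trans hf1.symm)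
  · split_ifs
    exacts [le_rfl, hf t]
  · rw [if_neg hn]
    exact lt_of_le_of_ne (hf s) hs.symm

/-- The part of the probability of a (reversed) record contributed by nature and player 1. -/
def recWeight (q : K → I → J → K × C × D → ℝ) (π : K × C × D → ℝ) (σ : Strat1 C I) :
    List (K × C × D × I × J) → (K × C × D) → ℝ
  | [], s => π s
  | z :: rest, s =>
      recWeight q π σ rest (z.1, z.2.1, z.2.2.1) *
        σ.play (p1hist rest.reverse) z.2.1 z.2.2.2.1 *
        q z.1 z.2.2.2.1 z.2.2.2.2 s

/-- Player 2's reversed private history, as reconstructed by a more informed player 1. -/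
def inferP2hist (dhat : C → D) (jhat : D → J) : List (C × I) → C → List (D × J)
  | [], _ => []
  | z :: rest, c => (dhat z.1, jhat (dhat c)) :: inferP2hist dhat jhat rest z.1

/-- On records of nonzero weight, player 1's private history determines player 2's. -/
theorem p2hist_eq_inferP2hist {q : K → I → J → K × C × D → ℝ} {π : K × C × D → ℝ}
    {σ : Strat1 C I} {dhat : C → D} {jhat : D → J}
    (hq : ∀ k i j s, q k i j s ≠ 0 → dhat s.2.1 = s.2.2 ∧ jhat s.2.2 = j)
    (hπ : ∀ s, π s ≠ 0 → dhat s.2.1 = s.2.2)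
    (r : List (K × C × D × I × J)) (s : K × C × D) (hr : recWeight q π σ r s ≠ 0) :
    p2hist r = inferP2hist dhat jhat (p1hist r) s.2.1 ∧ dhat s.2.1 = s.2.2 := by
  induction r generalizing s with
  | nil => exact ⟨rfl, hπ s hr⟩
  | cons z rest ih =>
    rw [recWeight] at hr
    obtain ⟨h₁, h₂⟩ := ih _ (left_ne_zero_of_mul (left_ne_zero_of_mul hr))
    obtain ⟨h₃, h₄⟩ := hq _ _ _ _ (right_ne_zero_of_mul hr)
    refine ⟨?_, h₃⟩
    have e₂ : p2hist (z :: rest) = (z.2.2.1, z.2.2.2.2) :: p2hist rest := rfl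
    have e₁ : p1hist (z :: rest) = (z.2.1, z.2.2.2.1) :: p1hist rest := rfl
    rw [e₂, e₁, inferP2hist, h₃, h₄, ← h₁, h₂]

theorem p2hist_reverse_eq_inferP2hist {q : K → I → J → K × C × D → ℝ} {π : K × C × D → ℝ}
    {σ : Strat1 C I} {dhat : C → D} {jhat : D → J}
    (hq : ∀ k i j s, q k i j s ≠ 0 → dhat s.2.1 = s.2.2 ∧ jhat s.2.2 = j)
    (hπ : ∀ s, π s ≠ 0 → dhat s.2.1 = s.2.2)
    (r : List (K × C × D × I × J)) (s : K × C × D) (hr : recWeight q π σ r.reverse s ≠ 0) :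
    (p2hist r).reverse = inferP2hist dhat jhat (p1hist r).reverse s.2.1 := by
  have h₂ : p2hist r.reverse = (p2hist r).reverse := List.map_reverse
  have h₁ : p1hist r.reverse = (p1hist r).reverse := List.map_reverse
  rw [← h₁, ← h₂]
  exact (p2hist_eq_inferP2hist hq hπ _ s hr).1

variable [Fintype J]

/-- The part of the probability of a record contributed by player 2, as a function of
player 2's reversed private history. -/
def p2Weight (τ : Strat2 D J) : List (D × J) → ℝ
  | [] => 1
  | z :: rest => p2Weight τ rest * τ.play rest.reverse z.1 z.2

theorem recProbAux_eq (q : K → I → J → K × C × D → ℝ) (π : K × C × D → ℝ)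
    (σ : Strat1 C I) (τ : Strat2 D J) (r : List (K × C × D × I × J)) (s : K × C × D) :
    recProbAux q π σ τ r s = recWeight q π σ r s * p2Weight τ (p2hist r) := by
  induction r generalizing s with
  | nil => simp [recProbAux, recWeight, p2Weight, p2hist]
  | cons z rest ih =>
    have h : p2hist (z :: rest) = (z.2.2.1, z.2.2.2.2) :: p2hist rest := rfl
    have h' : p2hist rest.reverse = (p2hist rest).reverse := List.map_reverse
    rw [h, recProbAux, recWeight, p2Weight, ih, h']
    ring

theorem recProb_eq (q : K → I → J → K × C × D → ℝ) (π : K × C × D → ℝ)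
    (σ : Strat1 C I) (τ : Strat2 D J) (r : List (K × C × D × I × J)) (s : K × C × D) :
    recProb q π σ τ r s =
      p2Weight τ (p2hist r).reverse * recWeight q π σ r.reverse s := by
  have h : p2hist r.reverse = (p2hist r).reverse := List.map_reverse
  rw [recProb, recProbAux_eq, h, mul_comm]

/-- If `P` fixes player 2's weight on all records of nonzero weight, this weight factors out
of the total probability of `P`. -/
theorem tsum_recProb_eq (q : K → I → J → K × C × D → ℝ) (π : K × C × D → ℝ)
    (σ : Strat1 C I) (τ : Strat2 D J) (P : List (K × C × D × I × J) × (K × C × D) → Prop)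
    [DecidablePred P] (h : List (D × J))
    (hP : ∀ rs, P rs → recWeight q π σ rs.1.reverse rs.2 ≠ 0 → (p2hist rs.1).reverse = h) :
    ∑' rs : List (K × C × D × I × J) × (K × C × D),
        (if P rs then recProb q π σ τ rs.1 rs.2 else 0) =
      p2Weight τ h * ∑' rs : List (K × C × D × I × J) × (K × C × D),
        (if P rs then recWeight q π σ rs.1.reverse rs.2 else 0) := by
  rw [← tsum_mul_left]
  refine tsum_congr fun rs => ?_
  split_ifs with hrs
  · rw [recProb_eq]
    by_cases hw : recWeight q π σ rs.1.reverse rs.2 = 0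
    · simp [hw]
    · rw [hP rs hrs hw]
  · simp

theorem p1histProb_eq {q : K → I → J → K × C × D → ℝ} {π : K × C × D → ℝ}
    {σ : Strat1 C I} {dhat : C → D} {jhat : D → J}
    (hq : ∀ k i j s, q k i j s ≠ 0 → dhat s.2.1 = s.2.2 ∧ jhat s.2.2 = j)
    (hπ : ∀ s, π s ≠ 0 → dhat s.2.1 = s.2.2) (τ : Strat2 D J) (h1 : List (C × I) × C) :
    p1histProb q π σ τ h1 = p2Weight τ (inferP2hist dhat jhat h1.1.reverse h1.2) *
      ∑' rs : List (K × C × D × I × J) × (K × C × D),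
        (if p1hist rs.1 = h1.1 ∧ rs.2.2.1 = h1.2 then
          recWeight q π σ rs.1.reverse rs.2 else 0) := by
  refine tsum_recProb_eq q π σ τ _ _ ?_
  rintro rs ⟨h, h'⟩ hw
  rw [← h, ← h']
  exact p2hist_reverse_eq_inferP2hist hq hπ rs.1 rs.2 hw

theorem p1jointProb_eq {q : K → I → J → K × C × D → ℝ} {π : K × C × D → ℝ}
    {σ : Strat1 C I} {dhat : C → D} {jhat : D → J}
    (hq : ∀ k i j s, q k i j s ≠ 0 → dhat s.2.1 = s.2.2 ∧ jhat s.2.2 = j)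
    (hπ : ∀ s, π s ≠ 0 → dhat s.2.1 = s.2.2) (τ : Strat2 D J) (h1 : List (C × I) × C) (k : K) :
    p1jointProb q π σ τ h1 k = p2Weight τ (inferP2hist dhat jhat h1.1.reverse h1.2) *
      ∑' rs : List (K × C × D × I × J) × (K × C × D),
        (if p1hist rs.1 = h1.1 ∧ rs.2.2.1 = h1.2 ∧ rs.2.1 = k then
          recWeight q π σ rs.1.reverse rs.2 else 0) := by
  refine tsum_recProb_eq q π σ τ _ _ ?_
  rintro rs ⟨h, h', -⟩ hw
  rw [← h, ← h']
  exact p2hist_reverse_eq_inferP2hist hq hπ rs.1 rs.2 hw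

theorem belief_eq_belief {q : K → I → J → K × C × D → ℝ} {π : K × C × D → ℝ}
    {σ : Strat1 C I} {dhat : C → D} {jhat : D → J}
    (hq : ∀ k i j s, q k i j s ≠ 0 → dhat s.2.1 = s.2.2 ∧ jhat s.2.2 = j)
    (hπ : ∀ s, π s ≠ 0 → dhat s.2.1 = s.2.2) {τ τ' : Strat2 D J} {h1 : List (C × I) × C}
    (hτ : p2Weight τ (inferP2hist dhat jhat h1.1.reverse h1.2) ≠ 0)
    (hτ' : p2Weight τ' (inferP2hist dhat jhat h1.1.reverse h1.2) ≠ 0) :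
    belief q π σ τ h1 = belief q π σ τ' h1 := by
  funext k
  simp only [belief, p1histProb_eq hq hπ, p1jointProb_eq hq hπ]
  rw [mul_div_mul_left _ _ hτ, mul_div_mul_left _ _ hτ']

theorem p2histProb_eq (q : K → I → J → K × C × D → ℝ) (π : K × C × D → ℝ)
    (σ : Strat1 C I) (τ : Strat2 D J) (h2 : List (D × J) × D) :
    p2histProb q π σ τ h2 = p2Weight τ h2.1.reverse *
      ∑' rs : List (K × C × D × I × J) × (K × C × D),
        (if p2hist rs.1 = h2.1 ∧ rs.2.2.2 = h2.2 then
          recWeight q π σ rs.1.reverse rs.2 else 0) :=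
  tsum_recProb_eq q π σ τ _ _ fun _ h _ => by rw [h.1]

theorem p2beliefJoint_eq [Fintype K] (q : K → I → J → K × C × D → ℝ) (π : K × C × D → ℝ)
    (σ : Strat1 C I) (τ : Strat2 D J) (h2 : List (D × J) × D) (φ : K → ℝ) :
    p2beliefJoint q π σ τ h2 φ = p2Weight τ h2.1.reverse *
      ∑' rs : List (K × C × D × I × J) × (K × C × D),
        (if p2hist rs.1 = h2.1 ∧ rs.2.2.2 = h2.2 ∧
            belief q π σ τ (p1hist rs.1, rs.2.2.1) = φ then
          recWeight q π σ rs.1.reverse rs.2 else 0) :=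
  tsum_recProb_eq q π σ τ _ _ fun _ h _ => by rw [h.1]

end SigGame

open SigGame in
/-- In a finite recursive game with signals in which player 1 is
more informed than player 2, for every initial distribution `π ∈ Δ¹(K×C×D)`, player
1's first-order belief `p_t` on the current state given his private history, and
player 2's second-order belief `x_t = L(p_t | h_t²)`, are independent of player 2's
strategy: on private histories of positive probability they take the same value
under `(σ, τ)` and `(σ, τ')` for any strategies `τ, τ'` of player 2. -/
theorem beliefs_independent_of_p2_strategy
    {K I J C D : Type} [Fintype K] [Fintype I] [Fintype J] [Fintype C] [Fintype D]
    [Nonempty I] [Nonempty J]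
    (g : K → I → J → ℝ) (hg : ∀ k i j, |g k i j| ≤ 1)
    (q : K → I → J → K × C × D → ℝ)
    (hq0 : ∀ k i j s, 0 ≤ q k i j s)
    (hq1 : ∀ k i j, ∑ s : K × C × D, q k i j s = 1)
    (ihat : C → I) (jhat : D → J)
    (hsig : ∀ k : K, ∀ i : I, ∀ j : J,
      ∑ s : K × C × D, (if ihat s.2.1 = i ∧ jhat s.2.2 = j then q k i j s else 0) = 1)
    (absorbK : K → Prop)
    (hact : ∀ k, ¬ absorbK k → ∀ i j, g k i j = 0)
    (habs : ∀ k, absorbK k → ∀ i j,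
      ∑ s : K × C × D, (if s.1 = k then q k i j s else 0) = 1)
    (habsg : ∀ k, absorbK k → ∀ i j i' j', g k i j = g k i' j')
    (dhat : C → D)
    (hinf : ∀ k i j,
      ∑ s : K × C × D, (if dhat s.2.1 = s.2.2 then q k i j s else 0) = 1)
    (π : K × C × D → ℝ) (hπ0 : ∀ s, 0 ≤ π s) (hπ1 : ∑ s : K × C × D, π s = 1)
    (hπ1inf : ∑ s : K × C × D, (if dhat s.2.1 = s.2.2 then π s else 0) = 1)
    (σ : Strat1 C I) (τ τ' : Strat2 D J) :
    (∀ h1 : List (C × I) × C,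
      0 < p1histProb q π σ τ h1 → 0 < p1histProb q π σ τ' h1 →
        belief q π σ τ h1 = belief q π σ τ' h1) ∧
    (∀ h2 : List (D × J) × D, ∀ φ : K → ℝ,
      0 < p2histProb q π σ τ h2 → 0 < p2histProb q π σ τ' h2 →
        p2beliefJoint q π σ τ h2 φ / p2histProb q π σ τ h2 =
          p2beliefJoint q π σ τ' h2 φ / p2histProb q π σ τ' h2) := by
  have hq : ∀ k i j s, q k i j s ≠ 0 → dhat s.2.1 = s.2.2 ∧ jhat s.2.2 = j :=
    fun k i j s hs => ⟨of_sum_ite_eq_one (P := fun s => dhat s.2.1 = s.2.2)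
        (hq0 k i j) (hq1 k i j) (hinf k i j) hs,
      (of_sum_ite_eq_one (P := fun s => ihat s.2.1 = i ∧ jhat s.2.2 = j)
        (hq0 k i j) (hq1 k i j) (hsig k i j) hs).2⟩
  have hπ : ∀ s, π s ≠ 0 → dhat s.2.1 = s.2.2 :=
    fun s hs => of_sum_ite_eq_one (P := fun s => dhat s.2.1 = s.2.2) hπ0 hπ1 hπ1inf hs
  refine ⟨fun h1 h h' => ?_, fun h2 φ h h' => ?_⟩
  · rw [p1histProb_eq hq hπ] at h h'
    exact belief_eq_belief hq hπ (left_ne_zero_of_mul h.ne') (left_ne_zero_of_mul h'.ne')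
  · rw [p2histProb_eq] at h h'
    have hτ := left_ne_zero_of_mul h.ne'
    have hτ' := left_ne_zero_of_mul h'.ne'
    rw [p2histProb_eq, p2histProb_eq, p2beliefJoint_eq, p2beliefJoint_eq,
      mul_div_mul_left _ _ hτ, mul_div_mul_left _ _ hτ']
    congr 1
    refine tsum_congr fun rs => ?_
    by_cases hw : recWeight q π σ rs.1.reverse rs.2 = 0
    · simp [hw]
    by_cases hrs : p2hist rs.1 = h2.1
    · have hr := p2hist_reverse_eq_inferP2hist hq hπ rs.1 rs.2 hw
      rw [hrs] at hr
      rw [hr] at hτ hτ'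
      rw [belief_eq_belief (h1 := (p1hist rs.1, rs.2.2.1)) hq hπ hτ hτ']
    · simp [hrs]
end
end

section
/- Let Γ be a positive-valued recursive game with fixed M > 0, n₀ ≥ 1 and n(·) : X⁰ → {1,…,n₀} such that v_{n(x)}(x) ≥ M for all x ∈ X⁰. Let σ̂ assign to each x ∈ X⁰ a strategy σ̂(x) optimal for player 1 in the n(x)-stage game Γ_{n(x)}(x), and let σ* be the concatenation of (σ̂(x_{u_l}))_{l≥0} along the random stages u₀ = 1 and u_{l+1} − u_l uniformly distributed on {1,…,n(x_{u_l})}. Then for every l* ≥ ln(ε)/ln(1−M) and every initial state x₁ ∈ X⁰ and every strategy τ of player 2, the probability (under the induced law of plays together with the randomization of the block lengths) that absorption has not occurred by stage n₀·l* is at most (1−M)^{l*} ≤ ε; in particular, the conditional probability of absorption during each block {u_{l−1},…,u_l − 1} is at least M. -/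
open scoped Classical
open Filter

noncomputable section

/-- A two-player zero-sum stochastic game: a state space `X`, action sets `A`, `B`
with a nonempty finite feasible subset at every state, a payoff function with values
in `[-1,1]`, and a finitely supported transition probability function. -/
structure StocGame where
  X : Type
  A : Type
  B : Type
  actA : X → Finset A
  actB : X → Finset B
  actA_nonempty : ∀ x, (actA x).Nonempty
  actB_nonempty : ∀ x, (actB x).Nonempty
  g : X → A → B → ℝ
  g_bdd : ∀ x a b, |g x a b| ≤ 1
  q : X → A → B → X → ℝ
  q_nonneg : ∀ x a b y, 0 ≤ q x a b y
  q_finsupp : ∀ x a b, (Function.support (q x a b)).Finite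
  q_sum : ∀ x a b, (∑' y, q x a b y) = 1

namespace StocGame

variable (G : StocGame)

/-- A behavior strategy of player 1: to every past history (a chronological list of
(state, action of player 1, action of player 2) triples) and every current state, it
assigns a mixed action supported on the feasible action set. -/
structure Strategy1 where
  play : List (G.X × G.A × G.B) → G.X → G.A → ℝ
  nonneg : ∀ h x a, 0 ≤ play h x a
  supp : ∀ h x a, a ∉ G.actA x → play h x a = 0
  sum_one : ∀ h x, ∑ a ∈ G.actA x, play h x a = 1

/-- A behavior strategy of player 2. -/
structure Strategy2 where
  play : List (G.X × G.A × G.B) → G.X → G.B → ℝ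
  nonneg : ∀ h x b, 0 ≤ play h x b
  supp : ∀ h x b, b ∉ G.actB x → play h x b = 0
  sum_one : ∀ h x, ∑ b ∈ G.actB x, play h x b = 1

variable {G}

/-- The chronological sequence of states visited along a finite history
(past history together with the current state). -/
def stateSeq (hx : List (G.X × G.A × G.B) × G.X) : List G.X :=
  hx.1.map Prod.fst ++ [hx.2]

/-- A strategy of player 1 which depends on the history only through the sequence of
visited states (and not on past actions). -/
def Strategy1.stateDep (σ : Strategy1 G) : Prop :=
  ∀ h h' x, h.map Prod.fst = h'.map Prod.fst → σ.play h x = σ.play h' x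

/-- A strategy of player 2 which depends on the history only through the sequence of
visited states (and not on past actions). -/
def Strategy2.stateDep (τ : Strategy2 G) : Prop :=
  ∀ h h' x, h.map Prod.fst = h'.map Prod.fst → τ.play h x = τ.play h' x

/-- A pure strategy of player 1. -/
def Strategy1.pure (σ : Strategy1 G) : Prop :=
  ∀ h x, ∃ a ∈ G.actA x, σ.play h x a = 1

/-- A pure strategy of player 2. -/
def Strategy2.pure (τ : Strategy2 G) : Prop :=
  ∀ h x, ∃ b ∈ G.actB x, τ.play h x b = 1

variable (G)

/-- Auxiliary function: the probability of a finite history, the past history being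
given in reverse chronological order. -/
def histProbAux (x₁ : G.X) (σ : Strategy1 G) (τ : Strategy2 G) :
    List (G.X × G.A × G.B) → G.X → ℝ
  | [], x => if x = x₁ then 1 else 0
  | (y, a, b) :: rest, x =>
      histProbAux x₁ σ τ rest y * σ.play rest.reverse y a * τ.play rest.reverse y b *
        G.q y a b x

/-- Probability, in the game starting at `x₁` played with `(σ, τ)`, that the play starts
with the (chronological) past history `h` followed by the current state `x`. -/
def histProb (x₁ : G.X) (σ : Strategy1 G) (τ : Strategy2 G)
    (h : List (G.X × G.A × G.B)) (x : G.X) : ℝ :=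
  G.histProbAux x₁ σ τ h.reverse x

/-- Expected payoff of stage `t` in the game starting at `x₁` played with `(σ, τ)`. -/
def stagePayoff (x₁ : G.X) (σ : Strategy1 G) (τ : Strategy2 G) (t : ℕ) : ℝ :=
  ∑' hx : List (G.X × G.A × G.B) × G.X,
    if hx.1.length + 1 = t then
      G.histProb x₁ σ τ hx.1 hx.2 *
        ∑ a ∈ G.actA hx.2, ∑ b ∈ G.actB hx.2,
          σ.play hx.1 hx.2 a * τ.play hx.1 hx.2 b * G.g hx.2 a b
    else 0

/-- Expected average payoff `γ_n(x₁, σ, τ)` over the `n` first stages. -/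
def avgPayoff (x₁ : G.X) (σ : Strategy1 G) (τ : Strategy2 G) (n : ℕ) : ℝ :=
  (n : ℝ)⁻¹ * ∑ t ∈ Finset.Icc 1 n, G.stagePayoff x₁ σ τ t

/-- Expected `λ`-discounted payoff `γ_λ(x₁, σ, τ)`. -/
def discPayoff (x₁ : G.X) (σ : Strategy1 G) (τ : Strategy2 G) (lam : ℝ) : ℝ :=
  ∑' t : ℕ, lam * (1 - lam) ^ t * G.stagePayoff x₁ σ τ (t + 1)

/-- The value `v_n(x₁)` of the `n`-stage game (by the minmax theorem, the game has a
value, which is then equal to this maxmin). -/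
def nValue (n : ℕ) (x₁ : G.X) : ℝ :=
  ⨆ σ : Strategy1 G, ⨅ τ : Strategy2 G, G.avgPayoff x₁ σ τ n

/-- The value `v_λ(x₁)` of the `λ`-discounted game. -/
def lamValue (lam : ℝ) (x₁ : G.X) : ℝ :=
  ⨆ σ : Strategy1 G, ⨅ τ : Strategy2 G, G.discPayoff x₁ σ τ lam

/-- The pointwise limit superior `v(x) = limsup_n v_n(x)` of the `n`-stage values. -/
def limsupV (x : G.X) : ℝ := Filter.limsup (fun n => G.nValue n x) Filter.atTop

/-- The family `{v_n, n ≥ 1}` is totally bounded for the uniform norm: for every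
`ε > 0` there is a finite subfamily within uniform distance `ε` of every member. -/
def TotallyBoundedValues : Prop :=
  ∀ ε > (0 : ℝ), ∃ S : Finset ℕ, (∀ m ∈ S, 1 ≤ m) ∧
    ∀ n, 1 ≤ n → ∃ m ∈ S, ∀ x, |G.nValue n x - G.nValue m x| ≤ ε

/-- Probability that the sequence of the first states of the play is `s`. -/
def statesProb (x₁ : G.X) (σ : Strategy1 G) (τ : Strategy2 G) (s : List G.X) : ℝ :=
  ∑' hx : List (G.X × G.A × G.B) × G.X,
    if stateSeq hx = s then G.histProb x₁ σ τ hx.1 hx.2 else 0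

end StocGame

/-- A two-player zero-sum recursive game: a stochastic game whose state space is
partitioned into active states (where the payoff is `0`) and absorbing states (which
are trapping, with a payoff depending only on the state). -/
structure RecGame extends StocGame where
  absorbing : X → Prop
  g_active : ∀ x a b, ¬ absorbing x → g x a b = 0
  absorbing_q : ∀ x a b, absorbing x → q x a b x = 1
  absorbing_g : ∀ x a b a' b', absorbing x → g x a b = g x a' b'

namespace RecGame

variable (G : RecGame)

/-- The stage payoff as a function of the state only: `0` on active states, and the
absorbing payoff on absorbing states. -/
def stateg (x : G.X) : ℝ :=
  G.g x (G.actA_nonempty x).choose (G.actB_nonempty x).choose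

/-- Probability that the play is absorbed within the first `N` stages; since absorbing
states are trapping this is the probability that the state of stage `N` is absorbing,
i.e. `P(ρ ≤ N)` where `ρ` is the absorption time. -/
def absorbedProb (x₁ : G.X) (σ : G.toStocGame.Strategy1) (τ : G.toStocGame.Strategy2)
    (N : ℕ) : ℝ :=
  ∑' hx : List (G.X × G.A × G.B) × G.X,
    if hx.1.length + 1 = N ∧ G.absorbing hx.2 then
      G.toStocGame.histProb x₁ σ τ hx.1 hx.2 else 0

/-- A uniformly terminating strategy of player 1. -/
def UniformlyTerminating1 (σ : G.toStocGame.Strategy1) : Prop :=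
  ∀ ε > (0 : ℝ), ∃ N : ℕ, 1 ≤ N ∧ ∀ x₁, ¬ G.absorbing x₁ →
    ∀ τ, G.absorbedProb x₁ σ τ N ≥ 1 - ε

end RecGame

namespace RecGame

variable {G : RecGame}

/-- The sequence of random stages `(u_l)`: `u_0 = 1` and
`u_{l+1} − u_l = (ω_l mod n(x_{u_l})) + 1`, which is uniformly distributed on
`{1,…,n(x_{u_l})}` when `ω_l` is uniformly distributed on `{0,…,n₀! − 1}` (since
`n(x)` divides `n₀!`). Here `s` is the chronological sequence of states and `x₀` a
default state. -/
def uSeq (nmap : G.X → ℕ) (ω : ℕ → ℕ) (s : List G.X) (x₀ : G.X) : ℕ → ℕ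
  | 0 => 1
  | l + 1 =>
      uSeq nmap ω s x₀ l +
        (ω l % max 1 (nmap (s.getD (uSeq nmap ω s x₀ l - 1) x₀))) + 1

/-- The start stage of the current block: the largest `u_l` not exceeding `t`. -/
def blockStart (nmap : G.X → ℕ) (ω : ℕ → ℕ) (s : List G.X) (x₀ : G.X) (t : ℕ) : ℕ :=
  ((List.range (t + 1)).filter (fun l => uSeq nmap ω s x₀ l ≤ t)).foldr
    (fun l r => max (uSeq nmap ω s x₀ l) r) 1

/-- The concatenated strategy `σ*` for a fixed draw sequence `ω`: on each block
`{u_l, …, u_{l+1} − 1}` the player forgets the past and plays `σ̂(x_{u_l})` restarted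
at the current state `x_{u_l}`. -/
def sigmaStarDet (G : RecGame) (nmap : G.X → ℕ)
    (σhat : G.X → G.toStocGame.Strategy1) (ω : ℕ → ℕ) : G.toStocGame.Strategy1 where
  play h x :=
    (σhat ((StocGame.stateSeq (h, x)).getD
        (blockStart nmap ω (StocGame.stateSeq (h, x)) x (h.length + 1) - 1) x)).play
      (h.drop (blockStart nmap ω (StocGame.stateSeq (h, x)) x (h.length + 1) - 1)) x
  nonneg := fun h x a => (σhat _).nonneg _ _ _
  supp := fun h x a ha => (σhat _).supp _ _ _ ha
  sum_one := fun h x => (σhat _).sum_one _ _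

/-- A finite tuple of draws, extended to an infinite draw sequence. -/
def extendDraws (l : ℕ) (m : ℕ) (w : Fin l → Fin m) : ℕ → ℕ :=
  fun i => if h : i < l then (w ⟨i, h⟩ : ℕ) else 0

/-- The probability, under the concatenated strategy `σ*` (averaging over the
uniform randomization of the block lengths), that no absorption occurs during the
first `N` stages. -/
def starNotAbsorbed (G : RecGame) (nmap : G.X → ℕ)
    (σhat : G.X → G.toStocGame.Strategy1) (n₀ : ℕ) (x₁ : G.X)
    (τ : G.toStocGame.Strategy2) (N : ℕ) : ℝ :=
  (∑ w : Fin N → Fin (Nat.factorial n₀),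
      (1 - G.absorbedProb x₁
        (sigmaStarDet G nmap σhat (extendDraws N (Nat.factorial n₀) w)) τ N)) /
    ((Nat.factorial n₀ : ℝ) ^ N)

/-- The probability, under the concatenated strategy `σ*` (averaging over the
uniform randomization of the block lengths), of the event `ρ ≥ u_l`, i.e. that no
absorption occurs strictly before the random stage `u_l`. -/
def survProb (G : RecGame) (nmap : G.X → ℕ)
    (σhat : G.X → G.toStocGame.Strategy1) (n₀ : ℕ) (x₁ : G.X)
    (τ : G.toStocGame.Strategy2) (l : ℕ) : ℝ :=
  (∑ w : Fin l → Fin (Nat.factorial n₀),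
      ∑' hx : List (G.X × G.A × G.B) × G.X,
        if hx.1.length + 2 =
            uSeq nmap (extendDraws l (Nat.factorial n₀) w) (StocGame.stateSeq hx) x₁ l ∧
            ¬ G.absorbing hx.2 then
          G.toStocGame.histProb x₁
            (sigmaStarDet G nmap σhat (extendDraws l (Nat.factorial n₀) w)) τ hx.1 hx.2
        else 0) /
    ((Nat.factorial n₀ : ℝ) ^ l)

end RecGame
namespace StocGame

/-- The continuation of a strategy of player 2 after the history `h`. -/
def Strategy2.shift {G : StocGame} (τ : Strategy2 G) (h : List (G.X × G.A × G.B)) :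
    Strategy2 G where
  play h' x := τ.play (h ++ h') x
  nonneg h' := τ.nonneg (h ++ h')
  supp h' := τ.supp (h ++ h')
  sum_one h' := τ.sum_one (h ++ h')

variable (G : StocGame)

/-- A finite set containing every state that may follow `x`. -/
def succStates (x : G.X) : Finset G.X :=
  (G.actA x ×ˢ G.actB x).biUnion fun p => (G.q_finsupp x p.1 p.2).toFinset

/-- The probability of choosing a given action pair and of moving to a given next state. -/
def weight (σ : Strategy1 G) (τ : Strategy2 G) (h : List (G.X × G.A × G.B)) (x : G.X)
    (p : G.A × G.B × G.X) : ℝ :=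
  σ.play h x p.1 * τ.play h x p.2.1 * G.q x p.1 p.2.1 p.2.2

/-- The finite set of action pairs and next states from `x`. -/
def moves (x : G.X) : Finset (G.A × G.B × G.X) :=
  G.actA x ×ˢ G.actB x ×ˢ G.succStates x

/-- The one-stage transition operator on functions of the history and the current state. -/
def step (σ : Strategy1 G) (τ : Strategy2 G) :
    (List (G.X × G.A × G.B) → G.X → ℝ) →ₗ[ℝ] (List (G.X × G.A × G.B) → G.X → ℝ) where
  toFun f h x := ∑ p ∈ G.moves x, G.weight σ τ h x p * f (h ++ [(x, p.1, p.2.1)]) p.2.2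
  map_add' f f' := by
    funext h x
    simp [mul_add, Finset.sum_add_distrib]
  map_smul' c f := by
    funext h x
    simp only [Pi.smul_apply, smul_eq_mul, RingHom.id_apply, Finset.mul_sum]
    exact Finset.sum_congr rfl fun p _ => by ring

variable {G}

theorem step_apply (σ : Strategy1 G) (τ : Strategy2 G) (f : List (G.X × G.A × G.B) → G.X → ℝ)
    (h : List (G.X × G.A × G.B)) (x : G.X) :
    G.step σ τ f h x =
      ∑ p ∈ G.moves x, G.weight σ τ h x p * f (h ++ [(x, p.1, p.2.1)]) p.2.2 := rfl

theorem weight_nonneg (σ : Strategy1 G) (τ : Strategy2 G) (h : List (G.X × G.A × G.B))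
    (x : G.X) (p : G.A × G.B × G.X) : 0 ≤ G.weight σ τ h x p :=
  mul_nonneg (mul_nonneg (σ.nonneg _ _ _) (τ.nonneg _ _ _)) (G.q_nonneg _ _ _ _)

theorem weight_eq_zero (σ : Strategy1 G) (τ : Strategy2 G) (h : List (G.X × G.A × G.B))
    (x : G.X) (p : G.A × G.B × G.X) (hp : p ∉ G.moves x) : G.weight σ τ h x p = 0 := by
  obtain ⟨a, b, y⟩ := p
  unfold weight
  by_cases ha : a ∈ G.actA x
  · by_cases hb : b ∈ G.actB x
    · have hq : G.q x a b y = 0 := by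
        by_contra hq
        refine hp ?_
        simp only [moves, succStates, Finset.mem_product, Finset.mem_biUnion]
        exact ⟨ha, hb, (a, b), ⟨ha, hb⟩, by simpa using hq⟩
      simp [hq]
    · simp [τ.supp h x b hb]
  · simp [σ.supp h x a ha]

theorem sum_q_succStates {x : G.X} {a : G.A} {b : G.B} (ha : a ∈ G.actA x)
    (hb : b ∈ G.actB x) : ∑ y ∈ G.succStates x, G.q x a b y = 1 := by
  rw [← G.q_sum x a b]
  refine (tsum_eq_sum fun y hy => ?_).symm
  by_contra hq
  refine hy ?_
  simp only [succStates, Finset.mem_product, Finset.mem_biUnion]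
  exact ⟨(a, b), ⟨ha, hb⟩, by simpa using hq⟩

theorem sum_weight (σ : Strategy1 G) (τ : Strategy2 G) (h : List (G.X × G.A × G.B))
    (x : G.X) : ∑ p ∈ G.moves x, G.weight σ τ h x p = 1 := by
  simp only [moves, Finset.sum_product, weight, ← Finset.mul_sum]
  rw [← σ.sum_one h x]
  refine Finset.sum_congr rfl fun a ha => ?_
  have : ∀ b ∈ G.actB x, σ.play h x a * τ.play h x b * ∑ y ∈ G.succStates x, G.q x a b y =
      σ.play h x a * τ.play h x b := fun b hb => by rw [sum_q_succStates ha hb, mul_one]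
  rw [Finset.sum_congr rfl this, ← Finset.mul_sum, τ.sum_one, mul_one]

theorem step_const (σ : Strategy1 G) (τ : Strategy2 G) (c : ℝ) :
    G.step σ τ (fun _ _ => c) = fun _ _ => c := by
  funext h x
  rw [step_apply, ← Finset.sum_mul, sum_weight, one_mul]

theorem step_mono (σ : Strategy1 G) (τ : Strategy2 G) : Monotone (G.step σ τ) := by
  intro f f' hf h x
  exact Finset.sum_le_sum fun p _ =>
    mul_le_mul_of_nonneg_left (hf _ _) (weight_nonneg σ τ h x p)

theorem pow_step_mono (σ : Strategy1 G) (τ : Strategy2 G) (n : ℕ) :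
    Monotone (G.step σ τ ^ n) := by
  rw [Module.End.coe_pow]
  exact (step_mono σ τ).iterate n

theorem pow_step_const (σ : Strategy1 G) (τ : Strategy2 G) (c : ℝ) (n : ℕ) :
    (G.step σ τ ^ n) (fun _ _ => c) = fun _ _ => c := by
  induction n with
  | zero => rfl
  | succ n ih => rw [pow_succ, Module.End.mul_apply, step_const, ih]

theorem pow_step_antitone (σ : Strategy1 G) (τ : Strategy2 G)
    {f : List (G.X × G.A × G.B) → G.X → ℝ} (hf : G.step σ τ f ≤ f) :
    Antitone fun n => (G.step σ τ ^ n) f := by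
  refine antitone_nat_of_succ_le fun n => ?_
  rw [pow_succ, Module.End.mul_apply]
  exact pow_step_mono σ τ n hf

/-- Two iterated transition operators agree when the strategies and the final functions agree
on the histories satisfying an invariant. -/
theorem pow_step_congr {σ σ' : Strategy1 G} {τ : Strategy2 G}
    {f f' : List (G.X × G.A × G.B) → G.X → ℝ} {h₀ : List (G.X × G.A × G.B)}
    (I : List (G.X × G.A × G.B) → G.X → Prop)
    (hI : ∀ h x a b y, I h x → I (h ++ [(x, a, b)]) y) (n : ℕ) :
    ∀ (h : List (G.X × G.A × G.B)) (x : G.X), I h x →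
      (∀ h' x', I h' x' → h'.length < h.length + n → σ.play (h₀ ++ h') x' = σ'.play h' x') →
      (∀ h' x', I h' x' → h'.length = h.length + n → f (h₀ ++ h') x' = f' h' x') →
      (G.step σ τ ^ n) f (h₀ ++ h) x = (G.step σ' (τ.shift h₀) ^ n) f' h x := by
  induction n with
  | zero => exact fun h x hx _ hf => hf h x hx rfl
  | succ n ih =>
    intro h x hx hσ hf
    rw [pow_succ', pow_succ', Module.End.mul_apply, Module.End.mul_apply, step_apply, step_apply]
    refine Finset.sum_congr rfl fun p _ => ?_
    have hw : G.weight σ τ (h₀ ++ h) x p = G.weight σ' (τ.shift h₀) h x p := by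
      simp only [weight, hσ h x hx (by omega), Strategy2.shift]
    rw [hw, List.append_assoc, ih _ _ (hI h x p.1 p.2.1 p.2.2 hx)]
    · intro h' x' hh hl
      exact hσ h' x' hh (by simp at hl; omega)
    · intro h' x' hh hl
      exact hf h' x' hh (by simp at hl; omega)

theorem histProb_append_singleton (x₁ : G.X) (σ : Strategy1 G) (τ : Strategy2 G)
    (h : List (G.X × G.A × G.B)) (x : G.X) (p : G.A × G.B × G.X) :
    G.histProb x₁ σ τ (h ++ [(x, p.1, p.2.1)]) p.2.2 =
      G.histProb x₁ σ τ h x * G.weight σ τ h x p := by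
  simp only [histProb, List.reverse_append, List.reverse_singleton, List.singleton_append,
    histProbAux, List.reverse_reverse, weight]
  ring

/-- Extend a history with current state by one stage. -/
def extendHist (p : (List (G.X × G.A × G.B) × G.X) × G.A × G.B × G.X) :
    List (G.X × G.A × G.B) × G.X :=
  (p.1.1 ++ [(p.1.2, p.2.1, p.2.2.1)], p.2.2.2)

theorem extendHist_injective : Function.Injective (extendHist (G := G)) := by
  rintro ⟨⟨h, x⟩, a, b, y⟩ ⟨⟨h', x'⟩, a', b', y'⟩ hp
  simp only [extendHist, Prod.mk.injEq] at hp
  obtain ⟨h1, rfl⟩ := hp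
  have := List.append_inj' h1 rfl
  simp only [List.cons.injEq, Prod.mk.injEq, and_true] at this
  obtain ⟨rfl, rfl, rfl, rfl⟩ := this
  rfl

theorem exists_extendHist_eq {hx : List (G.X × G.A × G.B) × G.X} {n : ℕ}
    (hn : hx.1.length = n + 1) : ∃ p, extendHist p = hx ∧ p.1.1.length = n := by
  obtain ⟨h, x⟩ := hx
  obtain rfl | ⟨h', ⟨y, a, b⟩, rfl⟩ := List.eq_nil_or_concat h
  · simp at hn
  · exact ⟨((h', y), a, b, x), by simp [extendHist], by simpa using hn⟩

theorem finite_support_histProb (x₁ : G.X) (σ : Strategy1 G) (τ : Strategy2 G) (n : ℕ) :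
    {hx : List (G.X × G.A × G.B) × G.X |
      hx.1.length = n ∧ G.histProb x₁ σ τ hx.1 hx.2 ≠ 0}.Finite := by
  induction n with
  | zero =>
    refine (Set.finite_singleton (([], x₁) : List (G.X × G.A × G.B) × G.X)).subset ?_
    rintro ⟨h, x⟩ ⟨hl, hp⟩
    obtain rfl := List.length_eq_zero_iff.1 hl
    by_contra hx
    refine hp ?_
    have : x ≠ x₁ := fun e => hx (by simp [e])
    simp [histProb, histProbAux, this]
  | succ n ih =>
    refine (ih.biUnion fun hx _ =>
      ((G.moves hx.2).finite_toSet.image fun p => extendHist (hx, p))).subset ?_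
    rintro hx ⟨hl, hp⟩
    obtain ⟨⟨⟨h, x⟩, p⟩, rfl, hn⟩ := exists_extendHist_eq hl
    have hp' : G.histProb x₁ σ τ h x * G.weight σ τ h x p ≠ 0 := by
      rwa [← histProb_append_singleton]
    simp only [Set.mem_iUnion]
    refine ⟨(h, x), ⟨hn, left_ne_zero_of_mul hp'⟩, p, ?_, rfl⟩
    by_contra hm
    exact right_ne_zero_of_mul hp' (weight_eq_zero σ τ h x p hm)

/-- The expectation of a function of the history of length `n` is the iterated transition
operator evaluated at the initial state. -/
theorem hasSum_histProb (x₁ : G.X) (σ : Strategy1 G) (τ : Strategy2 G) (n : ℕ) :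
    ∀ f : List (G.X × G.A × G.B) → G.X → ℝ,
      HasSum (fun hx : List (G.X × G.A × G.B) × G.X =>
        if hx.1.length = n then G.histProb x₁ σ τ hx.1 hx.2 * f hx.1 hx.2 else 0)
        ((G.step σ τ ^ n) f [] x₁) := by
  induction n with
  | zero =>
    intro f
    convert hasSum_single (([], x₁) : List (G.X × G.A × G.B) × G.X) ?_ using 1
    · simp [histProb, histProbAux]
    · rintro ⟨h, x⟩ hx
      split_ifs with hl
      · obtain rfl := List.length_eq_zero_iff.1 hl
        have : x ≠ x₁ := fun e => hx (by simp [e])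
        simp [histProb, histProbAux, this]
      · rfl
  | succ n ih =>
    intro f
    set F : List (G.X × G.A × G.B) × G.X → ℝ := fun hx =>
      if hx.1.length = n + 1 then G.histProb x₁ σ τ hx.1 hx.2 * f hx.1 hx.2 else 0 with hF
    have hsum : Summable F := by
      refine summable_of_hasFiniteSupport ((finite_support_histProb x₁ σ τ (n + 1)).subset ?_)
      intro hx hne
      simp only [hF, Function.mem_support, ne_eq, ite_eq_right_iff, Classical.not_imp] at hne
      exact ⟨hne.1, left_ne_zero_of_mul hne.2⟩
    have h0 : ∀ hx ∉ Set.range (extendHist (G := G)), F hx = 0 := by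
      intro hx hr
      simp only [hF]
      split_ifs with hl
      · obtain ⟨p, rfl, _⟩ := exists_extendHist_eq hl
        exact (hr ⟨p, rfl⟩).elim
      · rfl
    have h1 : HasSum (F ∘ extendHist) (∑' hx, F hx) :=
      (extendHist_injective.hasSum_iff h0).2 hsum.hasSum
    have h2 := h1.prod_fiberwise (g := fun hx =>
      if hx.1.length = n then G.histProb x₁ σ τ hx.1 hx.2 * G.step σ τ f hx.1 hx.2 else 0) ?_
    · rw [pow_succ, Module.End.mul_apply, ← h2.unique (ih (G.step σ τ f))]
      exact hsum.hasSum
    · rintro ⟨h, x⟩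
      have hFe : ∀ p, (F ∘ extendHist) ((h, x), p) = if h.length = n then
          G.histProb x₁ σ τ h x * (G.weight σ τ h x p * f (h ++ [(x, p.1, p.2.1)]) p.2.2)
          else 0 := by
        intro p
        have := histProb_append_singleton x₁ σ τ h x p
        simp only [hF, Function.comp_apply, extendHist, List.length_append, List.length_singleton,
          Nat.add_right_cancel_iff, this, mul_assoc]
      simp only [hFe]
      split_ifs with hl
      · rw [step_apply, Finset.mul_sum]
        refine hasSum_sum_of_ne_finset_zero fun p hp => ?_
        rw [weight_eq_zero σ τ h x p hp]
        ring
      · exact hasSum_zero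

theorem stagePayoff_succ (x₁ : G.X) (σ : Strategy1 G) (τ : Strategy2 G) (n : ℕ) :
    G.stagePayoff x₁ σ τ (n + 1) = (G.step σ τ ^ n) (fun h x =>
      ∑ a ∈ G.actA x, ∑ b ∈ G.actB x, σ.play h x a * τ.play h x b * G.g x a b) [] x₁ := by
  rw [← (hasSum_histProb x₁ σ τ n _).tsum_eq]
  simp only [stagePayoff, Nat.add_right_cancel_iff]

end StocGame

namespace RecGame

variable {G : RecGame}

/-- The indicator of the event that the current state is active. -/
def act (G : RecGame) (_ : List (G.X × G.A × G.B)) (x : G.X) : ℝ :=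
  if G.absorbing x then 0 else 1

theorem act_le_one (h : List (G.X × G.A × G.B)) (x : G.X) : G.act h x ≤ 1 := by
  unfold act
  split_ifs <;> norm_num

theorem q_eq_zero_of_absorbing {x y : G.X} {a : G.A} {b : G.B} (hx : G.absorbing x)
    (hy : y ≠ x) : G.q x a b y = 0 := by
  have hs : Summable (G.q x a b) := summable_of_hasFiniteSupport (G.q_finsupp x a b)
  have h := hs.sum_le_tsum {y, x} fun z _ => G.q_nonneg x a b z
  rw [G.q_sum, Finset.sum_pair hy, G.absorbing_q x a b hx] at h
  linarith [G.q_nonneg x a b y]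

theorem step_act_le (σ : G.toStocGame.Strategy1) (τ : G.toStocGame.Strategy2) :
    G.toStocGame.step σ τ G.act ≤ G.act := by
  intro h x
  by_cases hx : G.absorbing x
  · have h0 : G.act h x = 0 := if_pos hx
    rw [h0, StocGame.step_apply]
    refine (Finset.sum_eq_zero fun p _ => ?_).le
    by_cases hp : p.2.2 = x
    · rw [hp, show G.act (h ++ [(x, p.1, p.2.1)]) x = 0 from if_pos hx, mul_zero]
    · rw [StocGame.weight, q_eq_zero_of_absorbing hx hp, mul_zero, zero_mul]
  · rw [show G.act h x = 1 from if_neg hx]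
    have := StocGame.step_mono σ τ (a := G.act) (b := fun _ _ => 1)
      (fun h x => act_le_one h x) h x
    rwa [StocGame.step_const] at this

theorem pow_step_act_antitone (σ : G.toStocGame.Strategy1) (τ : G.toStocGame.Strategy2) :
    Antitone fun n => (G.toStocGame.step σ τ ^ n) G.act :=
  StocGame.pow_step_antitone σ τ (step_act_le σ τ)

theorem one_sub_absorbedProb (x : G.X) (σ : G.toStocGame.Strategy1)
    (τ : G.toStocGame.Strategy2) (n : ℕ) :
    1 - G.absorbedProb x σ τ (n + 1) = (G.toStocGame.step σ τ ^ n) G.act [] x := by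
  have h1 : G.absorbedProb x σ τ (n + 1) =
      (G.toStocGame.step σ τ ^ n) ((fun _ _ => 1) - G.act) [] x := by
    rw [← (StocGame.hasSum_histProb x σ τ n _).tsum_eq, absorbedProb]
    refine tsum_congr fun hx => ?_
    by_cases hl : hx.1.length = n <;> by_cases ha : G.absorbing hx.2 <;> simp [hl, ha, act]
  rw [h1, map_sub, StocGame.pow_step_const]
  simp

theorem stagePayoff_le (x : G.X) (σ : G.toStocGame.Strategy1)
    (τ : G.toStocGame.Strategy2) (n : ℕ) :
    G.toStocGame.stagePayoff x σ τ (n + 1) ≤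
      1 - (G.toStocGame.step σ τ ^ n) G.act [] x := by
  have h1 : 1 - (G.toStocGame.step σ τ ^ n) G.act [] x =
      (G.toStocGame.step σ τ ^ n) ((fun _ _ => 1) - G.act) [] x := by
    rw [map_sub, StocGame.pow_step_const]
    simp
  rw [h1, StocGame.stagePayoff_succ]
  refine StocGame.pow_step_mono σ τ n (fun h y => ?_) [] x
  by_cases hy : G.absorbing y
  · change _ ≤ 1 - G.act h y
    rw [act, if_pos hy, sub_zero, ← σ.sum_one h y]
    refine Finset.sum_le_sum fun a _ => ?_
    calc ∑ b ∈ G.actB y, σ.play h y a * τ.play h y b * G.g y a b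
        ≤ ∑ b ∈ G.actB y, σ.play h y a * τ.play h y b :=
          Finset.sum_le_sum fun b _ => mul_le_of_le_one_right
            (mul_nonneg (σ.nonneg _ _ _) (τ.nonneg _ _ _)) (le_of_abs_le (G.g_bdd y a b))
      _ = σ.play h y a := by rw [← Finset.mul_sum, τ.sum_one, mul_one]
  · change _ ≤ 1 - G.act h y
    rw [act, if_neg hy, sub_self]
    refine (Finset.sum_eq_zero fun a _ => Finset.sum_eq_zero fun b _ => ?_).le
    rw [G.g_active y a b hy, mul_zero]

theorem sum_pow_step_act_le (x : G.X) (σ : G.toStocGame.Strategy1)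
    (τ : G.toStocGame.Strategy2) {n : ℕ} (hn : 1 ≤ n) :
    ∑ k ∈ Finset.range n, (G.toStocGame.step σ τ ^ k) G.act [] x ≤
      n * (1 - G.toStocGame.avgPayoff x σ τ n) := by
  have hn' : (n : ℝ) ≠ 0 := by positivity
  have h1 : (n : ℝ) * G.toStocGame.avgPayoff x σ τ n =
      ∑ k ∈ Finset.range n, G.toStocGame.stagePayoff x σ τ (k + 1) := by
    rw [StocGame.avgPayoff, mul_inv_cancel_left₀ hn', Finset.range_eq_Ico,
      Finset.sum_Ico_add' (fun t => G.toStocGame.stagePayoff x σ τ t) 0 n 1]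
    rfl
  have h2 := Finset.sum_le_sum fun k (_ : k ∈ Finset.range n) => stagePayoff_le x σ τ k
  rw [Finset.sum_sub_distrib] at h2
  simp only [Finset.sum_const, Finset.card_range, nsmul_eq_mul, mul_one] at h2
  rw [mul_sub, h1]
  linarith

theorem sum_range_mul_mod (f : ℕ → ℝ) (n c : ℕ) :
    ∑ i ∈ Finset.range (n * c), f (i % n) = c * ∑ k ∈ Finset.range n, f k := by
  induction c with
  | zero => simp
  | succ c ih =>
    rw [mul_add, mul_one, Finset.sum_range_add, ih]
    have : ∀ k ∈ Finset.range n, f ((n * c + k) % n) = f k := fun k hk => by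
      rw [Nat.mul_add_mod, Nat.mod_eq_of_lt (Finset.mem_range.1 hk)]
    rw [Finset.sum_congr rfl this]
    push_cast
    ring

/-- The length of a block started in the state `x` with the draw `k`. -/
def blockLen (nmap : G.X → ℕ) (k : ℕ) (x : G.X) : ℕ := k % max 1 (nmap x) + 1

variable (nmap : G.X → ℕ)

theorem uSeq_succ' (ω : ℕ → ℕ) (s : List G.X) (z : G.X) (l : ℕ) :
    uSeq nmap ω s z (l + 1) = uSeq nmap ω s z l +
      blockLen nmap (ω l) (s.getD (uSeq nmap ω s z l - 1) z) := rfl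

theorem uSeq_pos (ω : ℕ → ℕ) (s : List G.X) (z : G.X) (l : ℕ) :
    l + 1 ≤ uSeq nmap ω s z l := by
  induction l with
  | zero => simp [uSeq]
  | succ l ih =>
    rw [uSeq_succ', blockLen]
    omega

theorem uSeq_mono (ω : ℕ → ℕ) (s : List G.X) (z : G.X) : Monotone (uSeq nmap ω s z) :=
  monotone_nat_of_le_succ fun l => by
    rw [uSeq_succ']
    omega

theorem uSeq_le (ω : ℕ → ℕ) (s : List G.X) (z : G.X) (l : ℕ) :
    uSeq nmap ω s z l ≤ (∑ i ∈ Finset.range l, (ω i + 1)) + 1 := by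
  induction l with
  | zero => simp [uSeq]
  | succ l ih =>
    rw [uSeq_succ', Finset.sum_range_succ, blockLen]
    have := Nat.mod_le (ω l) (max 1 (nmap (s.getD (uSeq nmap ω s z l - 1) z)))
    omega

theorem uSeq_one {ω : ℕ → ℕ} {s : List G.X} {x : G.X} (z : G.X) (hs : s.head? = some x) :
    uSeq nmap ω s z 1 = blockLen nmap (ω 0) x + 1 := by
  obtain ⟨s', rfl⟩ := List.head?_eq_some_iff.1 hs
  simp [uSeq, blockLen]
  omega

/-- Removing the first block shifts the sequence of random stages. -/
theorem uSeq_succ_shift {ω : ℕ → ℕ} {s : List G.X} {x : G.X} (z : G.X)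
    (hs : s.head? = some x) (l : ℕ) :
    uSeq nmap ω s z (l + 1) = blockLen nmap (ω 0) x +
      uSeq nmap (fun i => ω (i + 1)) (s.drop (blockLen nmap (ω 0) x)) z l := by
  induction l with
  | zero =>
    rw [zero_add, uSeq_one nmap z hs]
    rfl
  | succ l ih =>
    rw [uSeq_succ', ih, uSeq_succ']
    have hp := uSeq_pos nmap (fun i => ω (i + 1)) (s.drop (blockLen nmap (ω 0) x)) z l
    have hg : s.getD (blockLen nmap (ω 0) x +
        uSeq nmap (fun i => ω (i + 1)) (s.drop (blockLen nmap (ω 0) x)) z l - 1) z =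
        (s.drop (blockLen nmap (ω 0) x)).getD
          (uSeq nmap (fun i => ω (i + 1)) (s.drop (blockLen nmap (ω 0) x)) z l - 1) z := by
      rw [List.getD_eq_getElem?_getD, List.getD_eq_getElem?_getD, List.getElem?_drop,
        Nat.add_sub_assoc (by omega)]
    rw [hg, Nat.add_assoc]

theorem foldr_max_le_iff (f : ℕ → ℕ) (L : List ℕ) (k : ℕ) :
    L.foldr (fun l r => max (f l) r) 1 ≤ k ↔ 1 ≤ k ∧ ∀ l ∈ L, f l ≤ k := by
  induction L with
  | nil => simp
  | cons a L ih =>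
    rw [List.foldr_cons, max_le_iff, ih, List.forall_mem_cons]
    tauto

theorem blockStart_le_iff (ω : ℕ → ℕ) (s : List G.X) (z : G.X) {t : ℕ} (ht : 1 ≤ t) (k : ℕ) :
    blockStart nmap ω s z t ≤ k ↔ ∀ l, uSeq nmap ω s z l ≤ t → uSeq nmap ω s z l ≤ k := by
  rw [blockStart, foldr_max_le_iff]
  simp only [List.mem_filter, List.mem_range, decide_eq_true_eq]
  constructor
  · rintro ⟨_, h⟩ l hl
    exact h l ⟨by have := uSeq_pos nmap ω s z l; omega, hl⟩
  · intro h
    exact ⟨h 0 ht, fun l hl => h l hl.2⟩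

theorem blockStart_pos (ω : ℕ → ℕ) (s : List G.X) (z : G.X) {t : ℕ} (ht : 1 ≤ t) :
    1 ≤ blockStart nmap ω s z t :=
  (blockStart_le_iff nmap ω s z ht _).1 le_rfl 0 ht

theorem blockStart_eq_one {ω : ℕ → ℕ} {s : List G.X} {x : G.X} (z : G.X)
    (hs : s.head? = some x) {t : ℕ} (ht : 1 ≤ t) (ht' : t ≤ blockLen nmap (ω 0) x) :
    blockStart nmap ω s z t = 1 := by
  refine le_antisymm ((blockStart_le_iff nmap ω s z ht 1).2 fun l hl => ?_)
    (blockStart_pos nmap ω s z ht)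
  cases l with
  | zero => exact le_rfl
  | succ l =>
    have := uSeq_mono nmap ω s z (Nat.le_add_left 1 l)
    rw [uSeq_one nmap z hs] at this
    omega

theorem blockStart_shift {ω : ℕ → ℕ} {s : List G.X} {x : G.X} (z : G.X)
    (hs : s.head? = some x) {t : ℕ} (ht : 1 ≤ t) :
    blockStart nmap ω s z (blockLen nmap (ω 0) x + t) = blockLen nmap (ω 0) x +
      blockStart nmap (fun i => ω (i + 1)) (s.drop (blockLen nmap (ω 0) x)) z t := by
  have ht' : 1 ≤ blockLen nmap (ω 0) x + t := by omega
  apply le_antisymm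
  · rw [blockStart_le_iff nmap ω s z ht']
    intro l hl
    cases l with
    | zero => exact Nat.le_add_right_of_le (by simp [uSeq, blockLen])
    | succ l =>
      rw [uSeq_succ_shift nmap z hs] at hl ⊢
      have := (blockStart_le_iff nmap (fun i => ω (i + 1))
        (s.drop (blockLen nmap (ω 0) x)) z ht _).1 le_rfl l (by omega)
      omega
  · have h := (blockStart_le_iff nmap ω s z ht' _).1 le_rfl
    have h2 := (blockStart_le_iff nmap (fun i => ω (i + 1))
        (s.drop (blockLen nmap (ω 0) x)) z ht
        (blockStart nmap ω s z (blockLen nmap (ω 0) x + t) - blockLen nmap (ω 0) x)).2 ?_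
    · have := h 1 (by rw [uSeq_one nmap z hs]; omega)
      rw [uSeq_one nmap z hs] at this
      omega
    · intro l hl
      have := h (l + 1) (by rw [uSeq_succ_shift nmap z hs]; omega)
      rw [uSeq_succ_shift nmap z hs] at this
      omega

end RecGame

namespace RecGame

variable {G : RecGame} (nmap : G.X → ℕ) (σhat : G.X → G.toStocGame.Strategy1)

theorem head_stateSeq_append {h : List (G.X × G.A × G.B)} {x x₀ : G.X} (a : G.A) (b : G.B)
    (y : G.X) (hx : (StocGame.stateSeq (h, x)).head? = some x₀) :
    (StocGame.stateSeq (h ++ [(x, a, b)], y)).head? = some x₀ := by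
  obtain ⟨s, hs⟩ := List.head?_eq_some_iff.1 hx
  refine List.head?_eq_some_iff.2 ⟨s ++ [y], ?_⟩
  rw [← List.cons_append, ← hs]
  simp [StocGame.stateSeq]

theorem sigmaStarDet_play_of_lt {ω : ℕ → ℕ} {h : List (G.X × G.A × G.B)} {x x₀ : G.X}
    (hx : (StocGame.stateSeq (h, x)).head? = some x₀)
    (hl : h.length < blockLen nmap (ω 0) x₀) :
    (sigmaStarDet G nmap σhat ω).play h x = (σhat x₀).play h x := by
  simp only [sigmaStarDet]
  rw [blockStart_eq_one nmap x hx (by omega) hl]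
  obtain ⟨s, hs⟩ := List.head?_eq_some_iff.1 hx
  simp [hs]

theorem sigmaStarDet_play_append {ω : ℕ → ℕ} {h : List (G.X × G.A × G.B)} {x₀ : G.X}
    (hh : (h.map Prod.fst).head? = some x₀) (hl : h.length = blockLen nmap (ω 0) x₀)
    (h' : List (G.X × G.A × G.B)) (x : G.X) :
    (sigmaStarDet G nmap σhat ω).play (h ++ h') x =
      (sigmaStarDet G nmap σhat fun i => ω (i + 1)).play h' x := by
  have hs : StocGame.stateSeq (h ++ h', x) = h.map Prod.fst ++ StocGame.stateSeq (h', x) := by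
    simp [StocGame.stateSeq]
  have hhead : (StocGame.stateSeq (h ++ h', x)).head? = some x₀ := by
    rw [hs, List.head?_append, hh]
    rfl
  have hdrop : (StocGame.stateSeq (h ++ h', x)).drop (blockLen nmap (ω 0) x₀) =
      StocGame.stateSeq (h', x) := by
    rw [hs, ← hl]
    exact List.drop_left' (by simp)
  have hb : blockStart nmap ω (StocGame.stateSeq (h ++ h', x)) x ((h ++ h').length + 1) =
      h.length + blockStart nmap (fun i => ω (i + 1)) (StocGame.stateSeq (h', x)) x
        (h'.length + 1) := by
    rw [List.length_append, Nat.add_assoc, hl,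
      blockStart_shift nmap x hhead (Nat.le_add_left 1 _), hdrop]
  have hp := blockStart_pos nmap (fun i => ω (i + 1)) (StocGame.stateSeq (h', x)) x
    (Nat.le_add_left 1 h'.length)
  simp only [sigmaStarDet]
  rw [hb, Nat.add_sub_assoc hp, hs, List.getD_append_right _ _ _ _ (by simp),
    List.length_map, Nat.add_sub_cancel_left, List.drop_append, List.drop_eq_nil_of_le (by omega)]
  simp

theorem pow_step_sigmaStarDet_of_le (ω : ℕ → ℕ) (τ : G.toStocGame.Strategy2) (x : G.X) {n : ℕ}
    (hn : n ≤ blockLen nmap (ω 0) x) {f f' : List (G.X × G.A × G.B) → G.X → ℝ}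
    (hf : ∀ h y, (StocGame.stateSeq (h, y)).head? = some x → h.length = n → f h y = f' h y) :
    (G.toStocGame.step (sigmaStarDet G nmap σhat ω) τ ^ n) f [] x =
      (G.toStocGame.step (σhat x) τ ^ n) f' [] x := by
  refine StocGame.pow_step_congr (h₀ := [])
    (fun h y => (StocGame.stateSeq (h, y)).head? = some x)
    (fun h y a b y' hy => head_stateSeq_append a b y' hy) n [] x rfl ?_ ?_
  · intro h y hy hl
    exact sigmaStarDet_play_of_lt nmap σhat hy (lt_of_lt_of_le (by simpa using hl) hn)
  · intro h y hy hl
    exact hf h y hy (by simpa using hl)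

/-- The expectation under the concatenated strategy decomposes at the end of the first block. -/
theorem pow_step_sigmaStarDet_add (ω : ℕ → ℕ) (τ : G.toStocGame.Strategy2) (x : G.X) (n : ℕ)
    {f : List (G.X × G.A × G.B) → G.X → ℝ}
    {f' : List (G.X × G.A × G.B) → List (G.X × G.A × G.B) → G.X → ℝ}
    (hf : ∀ h h' y, (h.map Prod.fst).head? = some x → h.length = blockLen nmap (ω 0) x →
      h'.length = n → f (h ++ h') y = f' h h' y) :
    (G.toStocGame.step (sigmaStarDet G nmap σhat ω) τ ^ (blockLen nmap (ω 0) x + n)) f [] x =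
      (G.toStocGame.step (σhat x) τ ^ blockLen nmap (ω 0) x) (fun h y =>
        (G.toStocGame.step (sigmaStarDet G nmap σhat fun i => ω (i + 1)) (τ.shift h) ^ n)
          (f' h) [] y) [] x := by
  rw [pow_add, Module.End.mul_apply]
  refine pow_step_sigmaStarDet_of_le nmap σhat ω τ x le_rfl fun h y hy hl => ?_
  have hh : (h.map Prod.fst).head? = some x := by
    cases h with
    | nil => simp [blockLen] at hl
    | cons p h => simpa [StocGame.stateSeq] using hy
  have := StocGame.pow_step_congr (σ := sigmaStarDet G nmap σhat ω)
    (σ' := sigmaStarDet G nmap σhat fun i => ω (i + 1)) (τ := τ) (f := f) (f' := f' h)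
    (h₀ := h) (fun _ _ => True) (fun _ _ _ _ _ _ => trivial) n [] y trivial
    (fun h' x' _ _ => sigmaStarDet_play_append nmap σhat hh hl h' x')
    (fun h' x' _ hl' => hf h h' x' hh hl (by simpa using hl'))
  rwa [List.append_nil] at this

/-- The indicator of the event that the next stage is `u_l` and the current state is active. -/
def blockEnd (ω : ℕ → ℕ) (z : G.X) (l : ℕ) (h : List (G.X × G.A × G.B)) (x : G.X) : ℝ :=
  if h.length + 2 = uSeq nmap ω (StocGame.stateSeq (h, x)) z l ∧ ¬ G.absorbing x then 1 else 0

/-- The probability that no absorption occurs before stage `u_l`, for fixed draws. -/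
def survDet (ω : ℕ → ℕ) (z : G.X) (l : ℕ) (x : G.X) (τ : G.toStocGame.Strategy2) : ℝ :=
  ∑' hx : List (G.X × G.A × G.B) × G.X,
    if hx.1.length + 2 = uSeq nmap ω (StocGame.stateSeq hx) z l ∧ ¬ G.absorbing hx.2 then
      G.toStocGame.histProb x (sigmaStarDet G nmap σhat ω) τ hx.1 hx.2
    else 0

theorem survDet_eq_sum (ω : ℕ → ℕ) (z : G.X) (l : ℕ) (x : G.X) (τ : G.toStocGame.Strategy2)
    {K : ℕ} (hK : ∑ i ∈ Finset.range l, (ω i + 1) ≤ K) :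
    survDet nmap σhat ω z l x τ = ∑ k ∈ Finset.range K,
      (G.toStocGame.step (sigmaStarDet G nmap σhat ω) τ ^ k) (blockEnd nmap ω z l) [] x := by
  rw [← (hasSum_sum fun k (_ : k ∈ Finset.range K) =>
    StocGame.hasSum_histProb x (sigmaStarDet G nmap σhat ω) τ k (blockEnd nmap ω z l)).tsum_eq]
  refine tsum_congr fun hx => ?_
  rw [Finset.sum_ite_eq]
  have hu := uSeq_le nmap ω (StocGame.stateSeq hx) z l
  by_cases hc : hx.1.length + 2 = uSeq nmap ω (StocGame.stateSeq hx) z l ∧ ¬ G.absorbing hx.2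
  · rw [if_pos hc, if_pos (Finset.mem_range.2 (by omega)), blockEnd, if_pos hc, mul_one]
  · rw [if_neg hc, blockEnd, if_neg hc, mul_zero, ite_self]

theorem survDet_one (ω : ℕ → ℕ) (z x : G.X) (τ : G.toStocGame.Strategy2) :
    survDet nmap σhat ω z 1 x τ =
      (G.toStocGame.step (σhat x) τ ^ (blockLen nmap (ω 0) x - 1)) G.act [] x := by
  have hle : blockLen nmap (ω 0) x ≤ ω 0 + 1 := Nat.succ_le_succ (Nat.mod_le _ _)
  have hpos : 1 ≤ blockLen nmap (ω 0) x := Nat.le_add_left 1 _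
  rw [survDet_eq_sum nmap σhat ω z 1 x τ (K := blockLen nmap (ω 0) x + ω 0 + 1)
    (by rw [Finset.sum_range_one]; omega), Finset.sum_eq_single (blockLen nmap (ω 0) x - 1)]
  · refine pow_step_sigmaStarDet_of_le nmap σhat ω τ x (by omega) fun h y hy hl => ?_
    rw [blockEnd, uSeq_one nmap z hy, act]
    by_cases ha : G.absorbing y
    · simp [ha]
    · simp only [ha, not_false_eq_true, and_true, if_false]
      exact if_pos (by omega)
  · intro k _ hk
    have h0 := StocGame.pow_step_congr (σ := sigmaStarDet G nmap σhat ω)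
      (σ' := sigmaStarDet G nmap σhat ω) (τ := τ) (f := blockEnd nmap ω z 1)
      (f' := fun _ _ => 0) (h₀ := [])
      (fun h y => (StocGame.stateSeq (h, y)).head? = some x)
      (fun h y a b y' hy => head_stateSeq_append a b y' hy) k [] x rfl (fun _ _ _ _ => rfl) ?_
    · rw [StocGame.pow_step_const] at h0
      exact h0
    · intro h y hy hl
      simp only [List.length_nil, zero_add] at hl
      rw [List.nil_append, blockEnd, uSeq_one nmap z hy]
      exact if_neg fun hc => by omega
  · intro hn
    exact (hn (Finset.mem_range.2 (by omega))).elim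

theorem survDet_succ (ω : ℕ → ℕ) (z : G.X) {l : ℕ} (hl : 1 ≤ l) (x : G.X)
    (τ : G.toStocGame.Strategy2) :
    survDet nmap σhat ω z (l + 1) x τ =
      (G.toStocGame.step (σhat x) τ ^ blockLen nmap (ω 0) x) (fun h y =>
        survDet nmap σhat (fun i => ω (i + 1)) z l y (τ.shift h)) [] x := by
  set K := ∑ i ∈ Finset.range (l + 1), (ω i + 1) with hK
  have hK' : ∑ i ∈ Finset.range l, (ω (i + 1) + 1) ≤ K := by
    rw [hK, Finset.sum_range_succ']
    omega
  rw [survDet_eq_sum nmap σhat ω z (l + 1) x τ (K := blockLen nmap (ω 0) x + K) (by omega),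
    Finset.sum_range_add, Finset.sum_eq_zero, zero_add]
  · have hs : (fun h y => survDet nmap σhat (fun i => ω (i + 1)) z l y (τ.shift h)) =
        ∑ k ∈ Finset.range K, fun h y =>
          (G.toStocGame.step (sigmaStarDet G nmap σhat fun i => ω (i + 1)) (τ.shift h) ^ k)
            (blockEnd nmap (fun i => ω (i + 1)) z l) [] y := by
      funext h y
      rw [survDet_eq_sum nmap σhat _ z l y _ hK', Finset.sum_apply, Finset.sum_apply]
    rw [hs, map_sum, Finset.sum_apply, Finset.sum_apply]
    refine Finset.sum_congr rfl fun k _ => ?_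
    refine pow_step_sigmaStarDet_add nmap σhat ω τ x k fun h h' y hh hhl _ => ?_
    have hseq : StocGame.stateSeq (h ++ h', y) =
        h.map Prod.fst ++ StocGame.stateSeq (h', y) := by simp [StocGame.stateSeq]
    have hhead : (StocGame.stateSeq (h ++ h', y)).head? = some x := by
      rw [hseq, List.head?_append, hh]
      rfl
    have hdrop : (StocGame.stateSeq (h ++ h', y)).drop (blockLen nmap (ω 0) x) =
        StocGame.stateSeq (h', y) := by
      rw [hseq, ← hhl]
      exact List.drop_left' (by simp)
    rw [blockEnd, blockEnd, uSeq_succ_shift nmap z hhead, hdrop, List.length_append, hhl]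
    simp only [Nat.add_assoc, Nat.add_left_cancel_iff]
  · intro k hk
    have hk' := Finset.mem_range.1 hk
    have h0 := pow_step_sigmaStarDet_of_le nmap σhat ω τ x hk'.le
      (f := blockEnd nmap ω z (l + 1)) (f' := fun _ _ => 0) fun h y hy hhl => ?_
    · rw [h0, StocGame.pow_step_const]
    · rw [blockEnd, uSeq_succ_shift nmap z hy]
      have := uSeq_pos nmap (fun i => ω (i + 1))
        ((StocGame.stateSeq (h, y)).drop (blockLen nmap (ω 0) x)) z l
      exact if_neg fun hc => by omega

end RecGame

namespace RecGame

variable {G : RecGame} (nmap : G.X → ℕ) (σhat : G.X → G.toStocGame.Strategy1)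

/-- Prepend a draw to a draw sequence. -/
def consDraw (k : ℕ) (ω : ℕ → ℕ) : ℕ → ℕ
  | 0 => k
  | i + 1 => ω i

/-- The average of a function of the draws over `L` uniform draws in `{0,…,m-1}`. -/
def avgDraws (m L : ℕ) (F : (ℕ → ℕ) → ℝ) : ℝ :=
  (∑ w : Fin L → Fin m, F (extendDraws L m w)) / (m : ℝ) ^ L

theorem extendDraws_cons {m L : ℕ} (k : Fin m) (w : Fin L → Fin m) :
    extendDraws (L + 1) m (Fin.cons k w) = consDraw k (extendDraws L m w) := by
  funext i
  cases i with
  | zero => simp [extendDraws, consDraw]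
  | succ i =>
    by_cases hi : i < L
    · have : (⟨i + 1, Nat.succ_lt_succ hi⟩ : Fin (L + 1)) = Fin.succ ⟨i, hi⟩ := rfl
      simp only [extendDraws, consDraw, hi, Nat.succ_lt_succ hi, dif_pos, this, Fin.cons_succ]
    · simp [extendDraws, consDraw, hi]

theorem avgDraws_succ (m L : ℕ) (F : (ℕ → ℕ) → ℝ) :
    avgDraws m (L + 1) F =
      (∑ k : Fin m, avgDraws m L fun ω => F (consDraw k ω)) / m := by
  simp only [avgDraws]
  rw [← Finset.sum_div, div_div, ← pow_succ,
    ← (Fin.consEquiv fun _ : Fin (L + 1) => Fin m).sum_comp, Fintype.sum_prod_type]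
  simp only [← extendDraws_cons]
  rfl

theorem avgDraws_mono {m L : ℕ} {F F' : (ℕ → ℕ) → ℝ} (h : ∀ ω, F ω ≤ F' ω) :
    avgDraws m L F ≤ avgDraws m L F' :=
  div_le_div_of_nonneg_right (Finset.sum_le_sum fun _ _ => h _) (by positivity)

theorem avgDraws_const {m : ℕ} (hm : 0 < m) (L : ℕ) (c : ℝ) :
    avgDraws m L (fun _ => c) = c := by
  have : (m : ℝ) ≠ 0 := by positivity
  simp only [avgDraws, Finset.sum_const, Finset.card_univ, Fintype.card_pi, Fintype.card_fin,
    Finset.prod_const, nsmul_eq_mul, Nat.cast_pow]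
  exact mul_div_cancel_left₀ c (pow_ne_zero L this)

theorem avgDraws_pow_step (m L : ℕ) (σ : G.toStocGame.Strategy1) (τ : G.toStocGame.Strategy2)
    (n : ℕ) (f : (ℕ → ℕ) → List (G.X × G.A × G.B) → G.X → ℝ)
    (h : List (G.X × G.A × G.B)) (x : G.X) :
    avgDraws m L (fun ω => (G.toStocGame.step σ τ ^ n) (f ω) h x) =
      (G.toStocGame.step σ τ ^ n) (fun h y => avgDraws m L fun ω => f ω h y) h x := by
  have : (fun h y => avgDraws m L fun ω => f ω h y) =
      ((m : ℝ) ^ L)⁻¹ • ∑ w : Fin L → Fin m, f (extendDraws L m w) := by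
    funext h y
    simp only [avgDraws, Pi.smul_apply, Finset.sum_apply, smul_eq_mul, div_eq_inv_mul]
  rw [this, map_smul, map_sum]
  simp only [avgDraws, Pi.smul_apply, Finset.sum_apply, smul_eq_mul, div_eq_inv_mul]

/-- The average probability of no absorption before stage `u_l`. -/
def survAvg (m : ℕ) (z : G.X) (l : ℕ) (x : G.X) (τ : G.toStocGame.Strategy2) : ℝ :=
  avgDraws m l fun ω => survDet nmap σhat ω z l x τ

/-- The average probability of no absorption during the first block. -/
def firstBlockSurv (m : ℕ) (x : G.X) (τ : G.toStocGame.Strategy2) : ℝ :=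
  (∑ k : Fin m,
    (G.toStocGame.step (σhat x) τ ^ (blockLen nmap k x - 1)) G.act [] x) / m

theorem survAvg_one {m : ℕ} (hm : 0 < m) (z x : G.X) (τ : G.toStocGame.Strategy2) :
    survAvg nmap σhat m z 1 x τ = firstBlockSurv nmap σhat m x τ := by
  rw [survAvg, avgDraws_succ]
  simp only [survDet_one, consDraw, avgDraws_const hm, firstBlockSurv]

theorem survAvg_succ (m : ℕ) (z : G.X) {l : ℕ} (hl : 1 ≤ l) (x : G.X)
    (τ : G.toStocGame.Strategy2) :
    survAvg nmap σhat m z (l + 1) x τ = (∑ k : Fin m,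
      (G.toStocGame.step (σhat x) τ ^ blockLen nmap k x)
        (fun h y => survAvg nmap σhat m z l y (τ.shift h)) [] x) / m := by
  rw [survAvg, avgDraws_succ]
  simp only [survDet_succ nmap σhat _ z hl, consDraw, avgDraws_pow_step]
  rfl

variable {M : ℝ} {m : ℕ}

theorem firstBlockSurv_le {x : G.X} {τ : G.toStocGame.Strategy2} (hn : 1 ≤ nmap x)
    (hdvd : nmap x ∣ m) (hm : 0 < m)
    (hM : M ≤ G.toStocGame.avgPayoff x (σhat x) τ (nmap x)) :
    firstBlockSurv nmap σhat m x τ ≤ 1 - M := by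
  obtain ⟨c, rfl⟩ := hdvd
  have hc : 0 < c := Nat.pos_of_mul_pos_left hm
  have hsum : ∑ k : Fin (nmap x * c),
      (G.toStocGame.step (σhat x) τ ^ (blockLen nmap k x - 1)) G.act [] x =
      c * ∑ k ∈ Finset.range (nmap x), (G.toStocGame.step (σhat x) τ ^ k) G.act [] x := by
    rw [← sum_range_mul_mod, Finset.sum_range]
    simp only [blockLen, Nat.add_sub_cancel, max_eq_right hn]
  have hle := sum_pow_step_act_le x (σhat x) τ hn
  rw [firstBlockSurv, hsum, div_le_iff₀ (by exact_mod_cast hm)]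
  have hn' : (0 : ℝ) < nmap x := by exact_mod_cast hn
  have hc' : (0 : ℝ) < c := by exact_mod_cast hc
  calc (c : ℝ) * _ ≤ c * (nmap x * (1 - G.toStocGame.avgPayoff x (σhat x) τ (nmap x))) :=
        mul_le_mul_of_nonneg_left hle hc'.le
    _ ≤ c * (nmap x * (1 - M)) := by gcongr
    _ = (1 - M) * ((nmap x * c : ℕ) : ℝ) := by
        push_cast
        ring

theorem firstBlockSurv_le_act (x : G.X) (τ : G.toStocGame.Strategy2)
    (hx : ¬ G.absorbing x → firstBlockSurv nmap σhat m x τ ≤ 1 - M) :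
    firstBlockSurv nmap σhat m x τ ≤ (1 - M) * G.act [] x := by
  by_cases ha : G.absorbing x
  · have h0 : G.act [] x = 0 := if_pos ha
    rw [h0, mul_zero, firstBlockSurv]
    refine div_nonpos_of_nonpos_of_nonneg (Finset.sum_nonpos fun k _ => ?_) (Nat.cast_nonneg m)
    have := pow_step_act_antitone (σhat x) τ (Nat.zero_le (blockLen nmap k x - 1)) [] x
    rw [← h0]
    exact this
  · rw [show G.act [] x = 1 from if_neg ha, mul_one]
    exact hx ha

/-- A bound at the start of the second block on the continuation gives a bound at the start of
the first block. -/
theorem sum_pow_step_le {c : ℝ} (hc : 0 ≤ c) (x : G.X) (τ : G.toStocGame.Strategy2)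
    {f : List (G.X × G.A × G.B) → G.X → ℝ} (hf : ∀ h y, f h y ≤ c * G.act h y) (k : ℕ) :
    (G.toStocGame.step (σhat x) τ ^ blockLen nmap k x) f [] x ≤
      c * (G.toStocGame.step (σhat x) τ ^ (blockLen nmap k x - 1)) G.act [] x := by
  calc _ ≤ (G.toStocGame.step (σhat x) τ ^ blockLen nmap k x) (c • G.act) [] x :=
        StocGame.pow_step_mono _ _ _ hf [] x
    _ = c * (G.toStocGame.step (σhat x) τ ^ blockLen nmap k x) G.act [] x := by
        rw [map_smul]
        rfl
    _ ≤ _ := mul_le_mul_of_nonneg_left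
        (pow_step_act_antitone (σhat x) τ (Nat.sub_le _ 1) [] x) hc

theorem survAvg_succ_le (hm : 0 < m) (hM : M ≤ 1)
    (hfirst : ∀ x τ, ¬ G.absorbing x → firstBlockSurv nmap σhat m x τ ≤ 1 - M) (z : G.X)
    {l : ℕ} (hl : 1 ≤ l) : ∀ (x : G.X) (τ : G.toStocGame.Strategy2),
    survAvg nmap σhat m z (l + 1) x τ ≤ (1 - M) * survAvg nmap σhat m z l x τ := by
  induction l, hl using Nat.le_induction with
  | base =>
    intro x τ
    rw [survAvg_succ nmap σhat m z le_rfl, survAvg_one nmap σhat hm, firstBlockSurv,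
      ← mul_div_assoc, Finset.mul_sum]
    refine div_le_div_of_nonneg_right (Finset.sum_le_sum fun k _ => ?_) (Nat.cast_nonneg m)
    refine sum_pow_step_le nmap σhat (sub_nonneg.2 hM) x τ (fun h y => ?_) k
    rw [survAvg_one nmap σhat hm]
    exact firstBlockSurv_le_act nmap σhat y _ (hfirst y _)
  | succ l hl ih =>
    intro x τ
    rw [survAvg_succ nmap σhat m z (Nat.le_add_left 1 l), survAvg_succ nmap σhat m z hl,
      ← mul_div_assoc, Finset.mul_sum]
    refine div_le_div_of_nonneg_right (Finset.sum_le_sum fun k _ => ?_) (Nat.cast_nonneg m)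
    calc _ ≤ (G.toStocGame.step (σhat x) τ ^ blockLen nmap k x)
          ((1 - M) • fun h y => survAvg nmap σhat m z l y (τ.shift h)) [] x :=
          StocGame.pow_step_mono _ _ _ (fun h y => ih y (τ.shift h)) [] x
      _ = _ := by
          rw [map_smul]
          rfl

/-- After `n₀ * l` stages absorption has occurred except with probability `(1 - M) ^ l`. -/
theorem avgDraws_pow_step_le (hm : 0 < m) (hM : M ≤ 1) {n₀ : ℕ}
    (hnmap : ∀ x, ¬ G.absorbing x → nmap x ≤ n₀) (hn₀ : 1 ≤ n₀)
    (hfirst : ∀ x τ, ¬ G.absorbing x → firstBlockSurv nmap σhat m x τ ≤ 1 - M)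
    {l : ℕ} (hl : 1 ≤ l) : ∀ (L N : ℕ) (x : G.X) (τ : G.toStocGame.Strategy2),
    l ≤ L → n₀ * l ≤ N + 1 →
    avgDraws m L (fun ω =>
      (G.toStocGame.step (sigmaStarDet G nmap σhat ω) τ ^ N) G.act [] x) ≤
      (1 - M) ^ l * G.act [] x := by
  have habs : ∀ (L N : ℕ) (x : G.X) (τ : G.toStocGame.Strategy2), G.absorbing x →
      avgDraws m L (fun ω =>
        (G.toStocGame.step (sigmaStarDet G nmap σhat ω) τ ^ N) G.act [] x) ≤ 0 := by
    intro L N x τ hx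
    rw [← avgDraws_const hm L 0]
    refine avgDraws_mono fun ω => ?_
    have := pow_step_act_antitone (sigmaStarDet G nmap σhat ω) τ (Nat.zero_le N) [] x
    exact this.trans (if_pos hx).le
  have hlen : ∀ (k : ℕ) (x : G.X), ¬ G.absorbing x → blockLen nmap k x ≤ n₀ := by
    intro k x hx
    have h1 := hnmap x hx
    have h2 := Nat.mod_lt k (show 0 < max 1 (nmap x) by omega)
    rw [blockLen]
    omega
  induction l, hl using Nat.le_induction with
  | base =>
    intro L N x τ hL hN
    obtain ⟨L, rfl⟩ := Nat.exists_eq_add_of_le' hL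
    by_cases hx : G.absorbing x
    · rw [show G.act [] x = 0 from if_pos hx, mul_zero]
      exact habs _ N x τ hx
    rw [pow_one]
    refine le_trans ?_ (firstBlockSurv_le_act nmap σhat x τ (hfirst x τ))
    rw [avgDraws_succ, firstBlockSurv]
    refine div_le_div_of_nonneg_right (Finset.sum_le_sum fun k _ => ?_) (Nat.cast_nonneg m)
    rw [← avgDraws_const hm L
      ((G.toStocGame.step (σhat x) τ ^ (blockLen nmap k x - 1)) G.act [] x)]
    refine avgDraws_mono fun ω => ?_
    have hk := hlen k x hx
    rw [← pow_step_sigmaStarDet_of_le nmap σhat (consDraw k ω) τ x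
      (n := blockLen nmap k x - 1) (Nat.sub_le _ 1) fun _ _ _ _ => rfl]
    exact pow_step_act_antitone _ τ (by omega) [] x
  | succ l hl ih =>
    intro L N x τ hL hN
    obtain ⟨L, rfl⟩ := Nat.exists_eq_add_of_le' (Nat.one_le_of_lt hL)
    by_cases hx : G.absorbing x
    · rw [show G.act [] x = 0 from if_pos hx, mul_zero]
      exact habs _ N x τ hx
    have hfb := firstBlockSurv_le_act nmap σhat x τ (hfirst x τ)
    have hpow : 0 ≤ (1 - M) ^ l := pow_nonneg (sub_nonneg.2 hM) l
    rw [pow_succ, mul_assoc]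
    refine le_trans ?_ (mul_le_mul_of_nonneg_left hfb hpow)
    rw [avgDraws_succ, firstBlockSurv, ← mul_div_assoc, Finset.mul_sum]
    refine div_le_div_of_nonneg_right (Finset.sum_le_sum fun k _ => ?_) (Nat.cast_nonneg m)
    have hk := hlen k x hx
    rw [mul_add, mul_one] at hN
    have hl' := Nat.le_mul_of_pos_right n₀ hl
    obtain ⟨j, rfl⟩ := Nat.exists_eq_add_of_le (show blockLen nmap k x ≤ N by omega)
    have hadd : ∀ ω, (G.toStocGame.step (sigmaStarDet G nmap σhat (consDraw k ω)) τ ^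
        (blockLen nmap k x + j)) G.act [] x =
        (G.toStocGame.step (σhat x) τ ^ blockLen nmap k x) (fun h y =>
          (G.toStocGame.step (sigmaStarDet G nmap σhat ω) (τ.shift h) ^ j) G.act [] y) [] x :=
      fun ω => pow_step_sigmaStarDet_add nmap σhat (consDraw k ω) τ x j
        (f' := fun _ => G.act) fun _ _ _ _ _ _ => rfl
    simp only [hadd]
    rw [avgDraws_pow_step]
    exact sum_pow_step_le nmap σhat hpow x τ
      (fun h y => ih L j y (τ.shift h) (by omega) (by omega)) k

end RecGame


/-- In a positive-valued recursive game with `M > 0`, `n₀ ≥ 1` and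
`n(·) : X⁰ → {1,…,n₀}` such that `v_{n(x)}(x) ≥ M` on active states, let `σ̂(x)` be
optimal for player 1 in the `n(x)`-stage game and let `σ*` be the concatenation of
the `σ̂(x_{u_l})` along the random stages `u_0 = 1`,
`u_{l+1} − u_l` uniform on `{1,…,n(x_{u_l})}`. Then for every `l* ≥ ln ε / ln (1−M)`,
every active initial state and every `τ`, the probability (under the law of plays
together with the randomization of the block lengths) that absorption has not
occurred by stage `n₀·l*` is at most `(1−M)^{l*} ≤ ε`; in particular the conditional
probability of absorption during each block is at least `M` (equivalently,
`P(ρ ≥ u_{l+1}) ≤ (1−M)·P(ρ ≥ u_l)`). -/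
theorem concatenated_strategy_uniform_termination
    (G : RecGame) (hcount : Countable G.X)
    (M : ℝ) (hM : 0 < M) (hM1 : M < 1) (n₀ : ℕ) (hn₀ : 1 ≤ n₀)
    (nmap : G.X → ℕ)
    (hnmap : ∀ x, ¬ G.absorbing x → 1 ≤ nmap x ∧ nmap x ≤ n₀)
    (hval : ∀ x, ¬ G.absorbing x → G.toStocGame.nValue (nmap x) x ≥ M)
    (σhat : G.X → G.toStocGame.Strategy1)
    (hσhat : ∀ x, ¬ G.absorbing x → ∀ τ : G.toStocGame.Strategy2,
      G.toStocGame.avgPayoff x (σhat x) τ (nmap x) ≥ G.toStocGame.nValue (nmap x) x) :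
    ∀ ε > (0 : ℝ), ∀ lstar : ℕ, (lstar : ℝ) ≥ Real.log ε / Real.log (1 - M) →
      ∀ x₁, ¬ G.absorbing x₁ → ∀ τ : G.toStocGame.Strategy2,
        (RecGame.starNotAbsorbed G nmap σhat n₀ x₁ τ (n₀ * lstar) ≤ (1 - M) ^ lstar ∧
          (1 - M) ^ lstar ≤ ε) ∧
        (∀ l : ℕ, 1 ≤ l →
          RecGame.survProb G nmap σhat n₀ x₁ τ (l + 1) ≤
            (1 - M) * RecGame.survProb G nmap σhat n₀ x₁ τ l) ∧
        RecGame.survProb G nmap σhat n₀ x₁ τ 1 ≤ 1 - M := by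
  intro ε hε lstar hlstar x₁ hx₁ τ
  have hm : 0 < Nat.factorial n₀ := Nat.factorial_pos n₀
  have hfirst : ∀ x τ, ¬ G.absorbing x →
      RecGame.firstBlockSurv nmap σhat (Nat.factorial n₀) x τ ≤ 1 - M := fun x τ hx =>
    RecGame.firstBlockSurv_le nmap σhat (hnmap x hx).1
      (Nat.dvd_factorial (hnmap x hx).1 (hnmap x hx).2) hm
      ((hval x hx).le.trans (hσhat x hx τ))
  refine ⟨⟨?_, ?_⟩, fun l hl => ?_, ?_⟩
  · cases lstar with
    | zero =>
      have h0 : ∀ σ : G.toStocGame.Strategy1, G.absorbedProb x₁ σ τ 0 = 0 := fun σ => by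
        simp [RecGame.absorbedProb]
      simp only [RecGame.starNotAbsorbed, mul_zero, h0, sub_zero, pow_zero]
      simp
    | succ l =>
      obtain ⟨N, hN⟩ := Nat.exists_eq_add_of_le'
        (Nat.one_le_iff_ne_zero.2 (Nat.mul_ne_zero (by omega) (Nat.succ_ne_zero l)) :
          1 ≤ n₀ * (l + 1))
      have h := RecGame.avgDraws_pow_step_le nmap σhat hm hM1.le (fun x hx => (hnmap x hx).2)
        hn₀ hfirst (Nat.le_add_left 1 l) (N + 1) N x₁ τ
        (hN ▸ Nat.le_mul_of_pos_left (l + 1) hn₀) hN.le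
      rw [show G.act [] x₁ = 1 from if_neg hx₁, mul_one] at h
      rw [hN, RecGame.starNotAbsorbed]
      simp only [RecGame.one_sub_absorbedProb]
      exact h
  · have h1M : 0 < 1 - M := by linarith
    have hlog : Real.log (1 - M) < 0 := Real.log_neg h1M (by linarith)
    rw [← Real.log_le_log_iff (pow_pos h1M _) hε, Real.log_pow]
    exact (div_le_iff_of_neg hlog).1 hlstar
  · exact RecGame.survAvg_succ_le nmap σhat hm hM1.le hfirst x₁ hl x₁ τ
  · exact (RecGame.survAvg_one nmap σhat hm x₁ x₁ τ).le.trans (hfirst x₁ τ hx₁)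
end
end
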